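/- arXiv:2201.05813 — 10 statements merged into one kernel-verified Lean document; each statement's English description precedes it below -/
import Mathlib

section
/- Let R = R_1 × … × R_ℓ be a product of finite local rings and let C ⊆ R^n be a nonzero R-linear code having a minimal system of generators of cardinality i. Then: (a) there exist v_1, …, v_i forming a minimal system of generators of C such that the set V = { e_j·v_k : j ∈ {1,…,ℓ}, k ∈ {1,…,i}, e_j·v_k ≠ 0 } is a minimal system of generators of C with |V| ≥ i; and (b) M(C) = max{ i ≥ 0 : C has a minimal system of generators of cardinality i }. -/
/-- Least cardinality of a system of generators of a submodule (`μ`), with `μ(0)=0`. -/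
noncomputable def mu (R : Type*) {M : Type*} [Semiring R] [AddCommMonoid M] [Module R M]
    (D : Submodule R M) : ℕ :=
  sInf {k | ∃ s : Finset M, s.card = k ∧ Submodule.span R (s : Set M) = D}

/-- `G` is a minimal system of generators of the submodule `D`. -/
def IsMinGenSet (R : Type*) {M : Type*} [Semiring R] [AddCommMonoid M] [Module R M]
    (G : Set M) (D : Submodule R M) : Prop :=
  Submodule.span R G = D ∧ ∀ G' ⊆ G, Submodule.span R G' = D → G' = G

/-- The socle `0 :_C J`, where `J` is the Jacobson radical of `R`. -/
noncomputable def socJ {R M : Type*} [CommRing R] [AddCommGroup M] [Module R M]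
    (C : Submodule R M) : Submodule R M :=
  C ⊓ ⨅ r ∈ (⊥ : Ideal R).jacobson, LinearMap.ker (LinearMap.lsmul R M r)

/-- `D ∈ 𝒮_j(C)`: `D` is a subcode of `C` having a minimal system of generators of card `j`. -/
def memS {R M : Type*} [Semiring R] [AddCommMonoid M] [Module R M]
    (j : ℕ) (C D : Submodule R M) : Prop :=
  D ≤ C ∧ ∃ G : Finset M, G.card = j ∧ IsMinGenSet R (↑G : Set M) D

/-- The (componentwise) support of a set of vectors. -/
noncomputable def suppOf {M : Type*} {u : ℕ} (σ : M → Fin u → ℕ) (D : Set M) : Fin u → ℕ :=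
  fun i => sSup ((fun v => σ v i) '' D)

/-- The `r`-th generalized weight `d_r(C)`. -/
noncomputable def dGW {R M : Type*} [Semiring R] [AddCommMonoid M] [Module R M] {u : ℕ}
    (σ : M → Fin u → ℕ) (r : ℕ) (C : Submodule R M) : ℕ :=
  sInf {w | ∃ j, r ≤ j ∧ ∃ D : Submodule R M, memS j C D ∧ w = ∑ i, suppOf σ (D : Set M) i}

/-- `σ` is a support on `R^n`: (P1), (P2), (P3). -/
def IsSupport {R : Type*} [CommRing R] {n u : ℕ} (σ : (Fin n → R) → Fin u → ℕ) : Prop :=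
  (∀ v, σ v = 0 ↔ v = 0) ∧ (∀ (r : R) (v), σ (r • v) ≤ σ v) ∧ (∀ v w, σ (v + w) ≤ σ v ⊔ σ w)

/-- `σ` is modular: property (P⋆). -/
def IsModular {R : Type*} [CommRing R] {n u : ℕ} (σ : (Fin n → R) → Fin u → ℕ) : Prop :=
  ∀ v w (i : Fin u), σ v i ≠ 0 → σ v i ≤ σ w i → ∃ r : R, σ (v + r • w) i < σ v i

/-- The set of minimal (support) elements of a set `S` w.r.t. `σ`. -/
def MinSet {M : Type*} [Zero M] {u : ℕ} (σ : M → Fin u → ℕ) (S : Set M) : Set M :=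
  {v | v ∈ S ∧ v ≠ 0 ∧ ∀ w ∈ S, w ≠ 0 → σ w ≤ σ v → σ w = σ v}

/-- The `j`-th projected code `C_j ⊆ R_j^n`. -/
noncomputable def projCode {ℓ n : ℕ} {Rj : Fin ℓ → Type*} [∀ j, CommRing (Rj j)]
    (C : Submodule (∀ j, Rj j) (Fin n → ∀ j, Rj j)) (j : Fin ℓ) :
    Submodule (Rj j) (Fin n → Rj j) :=
  Submodule.span (Rj j) {w | ∃ v ∈ C, w = fun i => v i j}

/-- `M(C) = μ(C_1) + ⋯ + μ(C_ℓ)`. -/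
noncomputable def Mnum {ℓ n : ℕ} {Rj : Fin ℓ → Type*} [∀ j, CommRing (Rj j)]
    (C : Submodule (∀ j, Rj j) (Fin n → ∀ j, Rj j)) : ℕ :=
  ∑ j, mu (Rj j) (projCode C j)

/-- Over a local ring, an irredundant finite family has at most as many members as any
finite set with the same span. -/
theorem card_le_of_irredundant {R M ι : Type*} [CommRing R] [IsLocalRing R] [AddCommGroup M]
    [Module R M] [Fintype ι] [DecidableEq ι] (x : ι → M)
    (hx : ∀ k, x k ∉ Submodule.span R (x '' {k}ᶜ)) (T : Finset M)
    (hT : Submodule.span R (T : Set M) = Submodule.span R (Set.range x)) :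
    Fintype.card ι ≤ T.card := by
  classical
  have hrel : ∀ c : ι → R, ∑ k, c k • x k = 0 → ∀ k, ¬ IsUnit (c k) := by
    intro c hc k hk
    apply hx k
    obtain ⟨u, hu⟩ := hk
    rw [← Finset.add_sum_erase _ _ (Finset.mem_univ k)] at hc
    have h1 : c k • x k ∈ Submodule.span R (x '' {k}ᶜ) := by
      rw [eq_neg_of_add_eq_zero_left hc]
      refine Submodule.neg_mem _ (Submodule.sum_mem _ fun m hm => Submodule.smul_mem _ _
        (Submodule.subset_span ⟨m, ?_, rfl⟩))
      simpa using hm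
    have h2 := Submodule.smul_mem _ (↑u⁻¹ : R) h1
    rwa [← hu, smul_smul, Units.inv_mul, one_smul] at h2
  have hA : ∀ t : T, ∃ a : ι → R, ∑ k, a k • x k = (t : M) := by
    intro t
    have : (t : M) ∈ Submodule.span R (Set.range x) := by
      rw [← hT]; exact Submodule.subset_span t.2
    exact (Submodule.mem_span_range_iff_exists_fun R).1 this
  have hB : ∀ k, ∃ b : T → R, ∑ t, b t • (t : M) = x k := by
    intro k
    have : x k ∈ Submodule.span R (Set.range (fun t : T => (t : M))) := by
      have e : Set.range (fun t : T => (t : M)) = (T : Set M) := by ext; simp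
      rw [e, hT]; exact Submodule.subset_span ⟨k, rfl⟩
    exact (Submodule.mem_span_range_iff_exists_fun R).1 this
  choose A hA using hA
  choose B hB using hB
  let A' : Matrix T ι R := Matrix.of A
  let B' : Matrix ι T R := Matrix.of B
  have hBA : ∀ k m, ¬ IsUnit ((B' * A' - 1 : Matrix ι ι R) k m) := by
    intro k
    apply hrel
    have h1 : ∑ m, (B' * A') k m • x m = x k := by
      simp only [Matrix.mul_apply, Finset.sum_smul]
      rw [Finset.sum_comm]
      conv_rhs => rw [← hB k]
      refine Finset.sum_congr rfl fun t _ => ?_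
      rw [← hA t, Finset.smul_sum]
      simp [A', B', mul_smul]
    have h2 : ∑ m, (1 : Matrix ι ι R) k m • x m = x k := by
      simp [Matrix.one_apply]
    simp only [Matrix.sub_apply, sub_smul, Finset.sum_sub_distrib, h1, h2, sub_self]
  have hmap : (B'.map (IsLocalRing.residue R)) * (A'.map (IsLocalRing.residue R)) = 1 := by
    rw [← Matrix.map_mul]
    ext k m
    have := (IsLocalRing.residue_eq_zero_iff _).2
      ((IsLocalRing.mem_maximalIdeal _).2 (hBA k m))
    rw [Matrix.sub_apply, map_sub, sub_eq_zero] at this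
    rw [Matrix.map_apply, this]
    by_cases h : k = m <;> simp [Matrix.one_apply, h]
  have h1 := Matrix.rank_mul_le_left (B'.map (IsLocalRing.residue R))
    (A'.map (IsLocalRing.residue R))
  rw [hmap, Matrix.rank_one] at h1
  have h2 := Matrix.rank_le_card_width (B'.map (IsLocalRing.residue R))
  simpa using h1.trans h2

theorem mu_eq_of_irredundant {R M ι : Type*} [CommRing R] [IsLocalRing R] [AddCommGroup M]
    [Module R M] [Fintype ι] [DecidableEq ι] (x : ι → M)
    (hx : ∀ k, x k ∉ Submodule.span R (x '' {k}ᶜ)) :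
    mu R (Submodule.span R (Set.range x)) = Fintype.card ι := by
  classical
  have hinj : Function.Injective x := by
    intro a b hab
    by_contra hne
    apply hx a
    rw [hab]
    exact Submodule.subset_span ⟨b, fun h => hne h.symm, rfl⟩
  have hmem : Fintype.card ι ∈ {k | ∃ s : Finset M, s.card = k ∧
      Submodule.span R (s : Set M) = Submodule.span R (Set.range x)} := by
    refine ⟨Finset.univ.image x, ?_, by simp⟩
    rw [Finset.card_image_of_injective _ hinj, Finset.card_univ]
  apply le_antisymm
  · exact Nat.sInf_le hmem
  · obtain ⟨s, hs, hs'⟩ := Nat.sInf_mem ⟨_, hmem⟩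
    unfold mu
    rw [← hs]
    exact card_le_of_irredundant x hx s hs'

/-- Irredundant spanning families give minimal systems of generators. -/
theorem isMinGenSet_image {R M ι : Type*} [Ring R] [AddCommGroup M] [Module R M]
    (x : ι → M) (P : Set ι) (D : Submodule R M) (hs : Submodule.span R (x '' P) = D)
    (hx : ∀ p ∈ P, Submodule.span R (x '' (P \ {p})) ≠ D) :
    IsMinGenSet R (x '' P) D ∧ Set.InjOn x P := by
  constructor
  · refine ⟨hs, fun G' hG' hG => ?_⟩
    refine Set.Subset.antisymm hG' ?_
    rintro _ ⟨p, hp, rfl⟩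
    by_contra hn
    apply hx p hp
    apply le_antisymm
    · rw [← hs]; exact Submodule.span_mono (Set.image_mono Set.sdiff_subset)
    · rw [← hG]
      refine Submodule.span_mono fun y hy => ?_
      obtain ⟨q, hq, rfl⟩ := hG' hy
      exact ⟨q, ⟨hq, fun h => hn (by rw [← Set.mem_singleton_iff.1 h]; exact hy)⟩, rfl⟩
  · intro p hp q hq h
    by_contra hne
    apply hx p hp
    rw [← hs]
    apply le_antisymm (Submodule.span_mono (Set.image_mono Set.sdiff_subset))
    rw [Submodule.span_le]
    rintro _ ⟨r, hr, rfl⟩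
    by_cases hrp : r = p
    · subst hrp
      exact Submodule.subset_span ⟨q, ⟨hq, fun h' => hne h'.symm⟩, h.symm⟩
    · exact Submodule.subset_span ⟨r, ⟨hr, hrp⟩, rfl⟩

/-- Coordinate projection as a semilinear map. -/
def evj {ℓ n : ℕ} (Rj : Fin ℓ → Type*) [∀ j, CommRing (Rj j)] (j : Fin ℓ) :
    (Fin n → ∀ j, Rj j) →ₛₗ[Pi.evalRingHom Rj j] (Fin n → Rj j) where
  toFun v := fun a => v a j
  map_add' _ _ := rfl
  map_smul' _ _ := rfl

theorem projCode_eq_map {ℓ n : ℕ} {Rj : Fin ℓ → Type*} [∀ j, CommRing (Rj j)]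
    (C : Submodule (∀ j, Rj j) (Fin n → ∀ j, Rj j)) (j : Fin ℓ) :
    haveI : RingHomSurjective (Pi.evalRingHom Rj j) :=
      ⟨Function.surjective_eval j⟩
    projCode C j = Submodule.map (evj Rj j) C := by
  haveI : RingHomSurjective (Pi.evalRingHom Rj j) := ⟨Function.surjective_eval j⟩
  unfold projCode
  have : {w | ∃ v ∈ C, w = fun i => v i j} =
      ((Submodule.map (evj Rj j) C : Submodule _ _) : Set (Fin n → Rj j)) := by
    ext w
    constructor
    · rintro ⟨v, hv, rfl⟩; exact ⟨v, hv, rfl⟩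
    · rintro ⟨v, hv, rfl⟩; exact ⟨v, hv, rfl⟩
  rw [this, Submodule.span_eq]

/-- Coordinate inclusion. -/
def incj {ℓ n : ℕ} (Rj : Fin ℓ → Type*) [∀ j, CommRing (Rj j)] (j : Fin ℓ)
    (y : Fin n → Rj j) : Fin n → ∀ j, Rj j := fun a => Pi.single j (y a)

theorem incj_mem_span {ℓ n : ℕ} {Rj : Fin ℓ → Type*} [∀ j, CommRing (Rj j)] (j : Fin ℓ)
    (S : Set (Fin n → Rj j)) (y : Fin n → Rj j) (hy : y ∈ Submodule.span (Rj j) S) :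
    incj Rj j y ∈ Submodule.span (∀ j, Rj j) (incj Rj j '' S) := by
  induction hy using Submodule.span_induction with
  | mem x h => exact Submodule.subset_span ⟨x, h, rfl⟩
  | zero =>
    have : incj Rj j (0 : Fin n → Rj j) = 0 := by funext a; simp [incj]
    rw [this]; exact Submodule.zero_mem _
  | add x y _ _ hx hy =>
    have : incj Rj j (x + y) = incj Rj j x + incj Rj j y := by
      funext a; simp [incj, Pi.single_add]
    rw [this]; exact Submodule.add_mem _ hx hy
  | smul c x _ hx =>
    have : incj Rj j (c • x) = (Pi.single j c : ∀ j, Rj j) • incj Rj j x := by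
      funext a; simp [incj, ← Pi.single_mul]
    rw [this]; exact Submodule.smul_mem _ _ hx

/-- Homogeneous parts. -/
def hom {ℓ n i : ℕ} {Rj : Fin ℓ → Type*} [∀ j, CommRing (Rj j)]
    (g : Fin i → (Fin n → ∀ j, Rj j)) (p : Fin ℓ × Fin i) : Fin n → ∀ j, Rj j :=
  (Pi.single p.1 1 : ∀ m, Rj m) • g p.2

theorem hom_eq_inc {ℓ n i : ℕ} {Rj : Fin ℓ → Type*} [∀ j, CommRing (Rj j)]
    (g : Fin i → (Fin n → ∀ j, Rj j)) (j : Fin ℓ) (k : Fin i) :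
    hom g (j, k) = incj Rj j (evj Rj j (g k)) := by
  funext a m
  by_cases h : m = j
  · subst h
    have : evj Rj m (g k) a = g k a m := rfl
    simp [hom, incj, this]
  · simp [hom, incj, h]

theorem sum_hom {ℓ n i : ℕ} {Rj : Fin ℓ → Type*} [∀ j, CommRing (Rj j)]
    (g : Fin i → (Fin n → ∀ j, Rj j)) (k : Fin i) : ∑ j, hom g (j, k) = g k := by
  funext a m
  simp only [hom, Finset.sum_apply, Pi.smul_apply, smul_eq_mul, Pi.mul_apply]
  rw [Finset.sum_eq_single m]
  · simp
  · intro b _ hb; simp [Ne.symm hb]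
  · simp

/-- An irredundant homogeneous spanning family has `M(C)` members. -/
theorem card_eq_Mnum {ℓ n i : ℕ} {Rj : Fin ℓ → Type*} [∀ j, CommRing (Rj j)]
    [∀ j, IsLocalRing (Rj j)]
    (C : Submodule (∀ j, Rj j) (Fin n → ∀ j, Rj j))
    (g : Fin i → (Fin n → ∀ j, Rj j)) (P : Finset (Fin ℓ × Fin i))
    (hs : Submodule.span (∀ j, Rj j) (hom g '' (P : Set (Fin ℓ × Fin i))) = C)
    (hx : ∀ p ∈ P, Submodule.span (∀ j, Rj j)
      (hom g '' ((P : Set (Fin ℓ × Fin i)) \ {p})) ≠ C) :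
    Mnum C = P.card := by
  classical
  unfold Mnum
  have key : ∀ j, mu (Rj j) (projCode C j) = (P.filter (fun p => p.1 = j)).card := by
    intro j
    let I := {k : Fin i // (j, k) ∈ P}
    let x : I → (Fin n → Rj j) := fun k => evj Rj j (g k.1)
    have hspan : projCode C j = Submodule.span (Rj j) (Set.range x) := by
      haveI : RingHomSurjective (Pi.evalRingHom Rj j) := ⟨Function.surjective_eval j⟩
      rw [projCode_eq_map, ← hs, Submodule.map_span]
      apply le_antisymm
      · rw [Submodule.span_le]
        rintro _ ⟨_, ⟨⟨j', k⟩, hp, rfl⟩, rfl⟩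
        by_cases h : j' = j
        · subst h
          refine Submodule.subset_span ⟨⟨k, hp⟩, ?_⟩
          funext a; simp [x, hom, evj]
        · have : evj Rj j (hom g (j', k)) = 0 := by
            funext a; simp [hom, evj, Ne.symm h]
          rw [this]; exact Submodule.zero_mem _
      · rw [Submodule.span_le]
        rintro _ ⟨⟨k, hk⟩, rfl⟩
        refine Submodule.subset_span ⟨_, ⟨(j, k), hk, rfl⟩, ?_⟩
        funext a; simp [x, hom, evj]
    have hirr : ∀ k, x k ∉ Submodule.span (Rj j) (x '' {k}ᶜ) := by
      rintro ⟨k, hk⟩ hmem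
      apply hx (j, k) hk
      rw [← hs]
      apply le_antisymm (Submodule.span_mono (Set.image_mono Set.sdiff_subset))
      rw [Submodule.span_le]
      rintro _ ⟨r, hr, rfl⟩
      by_cases hrp : r = (j, k)
      · subst hrp
        have h1 := incj_mem_span j _ _ hmem
        rw [SetLike.mem_coe, hom_eq_inc]
        refine Submodule.span_mono ?_ h1
        rintro _ ⟨_, ⟨⟨m, hm⟩, hmk, rfl⟩, rfl⟩
        refine ⟨(j, m), ⟨hm, ?_⟩, hom_eq_inc g j m⟩
        intro h
        apply hmk
        exact Subtype.ext (Prod.ext_iff.1 h).2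
      · exact Submodule.subset_span ⟨r, ⟨hr, hrp⟩, rfl⟩
    rw [hspan, mu_eq_of_irredundant x hirr, Fintype.card_subtype]
    refine Finset.card_bij (fun k _ => (j, k)) ?_ ?_ ?_
    · intro k hk; simpa using hk
    · intro a _ b _ h; simpa using h
    · rintro ⟨j', k⟩ h
      obtain ⟨h1, rfl⟩ := Finset.mem_filter.1 h
      exact ⟨k, by simpa using h1, rfl⟩
  simp only [key]
  exact (Finset.card_eq_sum_card_fiberwise (fun p _ => Finset.mem_univ p.1)).symm

theorem partA {ℓ n : ℕ} {Rj : Fin ℓ → Type*} [∀ j, CommRing (Rj j)]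
    [∀ j, IsLocalRing (Rj j)]
    (C : Submodule (∀ j, Rj j) (Fin n → ∀ j, Rj j))
    (i : ℕ) (G : Finset (Fin n → ∀ j, Rj j)) (hGcard : G.card = i)
    (hGmin : IsMinGenSet (∀ j, Rj j) (↑G : Set (Fin n → ∀ j, Rj j)) C) :
    ∃ v : Fin i → (Fin n → ∀ j, Rj j), Function.Injective v ∧
      IsMinGenSet (∀ j, Rj j) (Set.range v) C ∧
      IsMinGenSet (∀ j, Rj j)
        {w | w ≠ 0 ∧ ∃ (j : Fin ℓ) (k : Fin i), w = (Pi.single j 1 : ∀ m, Rj m) • v k} C ∧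
      i ≤ {w | w ≠ 0 ∧ ∃ (j : Fin ℓ) (k : Fin i),
            w = (Pi.single j 1 : ∀ m, Rj m) • v k}.ncard ∧
      {w | w ≠ 0 ∧ ∃ (j : Fin ℓ) (k : Fin i),
            w = (Pi.single j 1 : ∀ m, Rj m) • v k}.ncard = Mnum C ∧
      {w | w ≠ 0 ∧ ∃ (j : Fin ℓ) (k : Fin i),
            w = (Pi.single j 1 : ∀ m, Rj m) • v k}.Finite := by
  classical
  let R := ∀ j, Rj j
  let e : Fin i ≃ G := (G.equivFinOfCardEq hGcard).symm
  let g : Fin i → (Fin n → ∀ j, Rj j) := fun k => (e k : Fin n → ∀ j, Rj j)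
  have hginj : Function.Injective g := Subtype.val_injective.comp e.injective
  have hgr : Set.range g = (G : Set _) := by
    ext y; constructor
    · rintro ⟨k, rfl⟩; exact (e k).2
    · intro hy; exact ⟨e.symm ⟨y, hy⟩, by simp [g]⟩
  have hgirr : ∀ k, Submodule.span R (g '' {k}ᶜ) ≠ C := by
    intro k h
    have h1 := hGmin.2 (g '' {k}ᶜ) (by rw [← hgr]; exact Set.image_subset_range _ _) h
    have h2 : g k ∈ g '' {k}ᶜ := by rw [h1, ← hgr]; exact ⟨k, rfl⟩
    obtain ⟨m, hm, hmk⟩ := h2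
    exact hm (hginj hmk)
  have hgC : ∀ k, g k ∈ C := fun k => by
    rw [← hGmin.1, ← hgr]; exact Submodule.subset_span ⟨k, rfl⟩
  have hhC : ∀ p, hom g p ∈ C := fun p => Submodule.smul_mem _ _ (hgC _)
  -- choose a minimal spanning set of index pairs
  have huniv : Submodule.span R (hom g '' ((Finset.univ : Finset (Fin ℓ × Fin i)) :
      Set (Fin ℓ × Fin i))) = C := by
    apply le_antisymm
    · rw [Submodule.span_le]; rintro _ ⟨p, _, rfl⟩; exact hhC p
    · rw [← hGmin.1, Submodule.span_le, ← hgr]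
      rintro _ ⟨k, rfl⟩
      rw [SetLike.mem_coe, ← sum_hom g k]
      exact Submodule.sum_mem _ fun j _ => Submodule.subset_span ⟨(j, k), by simp, rfl⟩
  obtain ⟨P, -, hPmin⟩ := Finite.exists_le_minimal
    (p := fun Q : Finset (Fin ℓ × Fin i) =>
      Submodule.span R (hom g '' (Q : Set (Fin ℓ × Fin i))) = C) huniv
  have hP : Submodule.span R (hom g '' (P : Set (Fin ℓ × Fin i))) = C := hPmin.1
  have hPirr : ∀ p ∈ P, Submodule.span R
      (hom g '' ((P : Set (Fin ℓ × Fin i)) \ {p})) ≠ C := by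
    intro p hp h
    have h1 : P ≤ P.erase p := hPmin.2 (by simpa [Finset.coe_erase] using h)
      (Finset.erase_subset _ _)
    exact Finset.notMem_erase p P (h1 hp)
  let v : Fin i → (Fin n → ∀ j, Rj j) :=
    fun k => (fun j => if (j, k) ∈ P then 1 else 0 : ∀ j, Rj j) • g k
  have hv : ∀ j k, (Pi.single j 1 : ∀ m, Rj m) • v k = if (j, k) ∈ P then hom g (j, k) else 0 := by
    intro j k
    funext a m
    by_cases h : m = j
    · subst h
      by_cases h' : (m, k) ∈ P <;> simp [v, hom, h']
    · by_cases h' : (j, k) ∈ P <;> simp [v, hom, h', h]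
  have hne : ∀ p ∈ P, hom g p ≠ 0 := by
    intro p hp h0
    apply hPirr p hp
    rw [← hP]
    apply le_antisymm (Submodule.span_mono (Set.image_mono Set.sdiff_subset))
    rw [Submodule.span_le]
    rintro _ ⟨r, hr, rfl⟩
    by_cases hrp : r = p
    · subst hrp; rw [h0]; exact Submodule.zero_mem _
    · exact Submodule.subset_span ⟨r, ⟨hr, hrp⟩, rfl⟩
  have hV : {w | w ≠ 0 ∧ ∃ (j : Fin ℓ) (k : Fin i), w = (Pi.single j 1 : ∀ m, Rj m) • v k} =
      hom g '' (P : Set (Fin ℓ × Fin i)) := by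
    ext w
    constructor
    · rintro ⟨hw, j, k, rfl⟩
      rw [hv] at hw ⊢
      by_cases h : (j, k) ∈ P
      · rw [if_pos h]; exact ⟨_, h, rfl⟩
      · rw [if_neg h] at hw; exact absurd rfl hw
    · rintro ⟨⟨j, k⟩, hp, rfl⟩
      exact ⟨hne _ hp, j, k, by rw [hv, if_pos (Finset.mem_coe.1 hp)]⟩
  have hvs : Submodule.span R (v '' Set.univ) = C := by
    apply le_antisymm
    · rw [Submodule.span_le]; rintro _ ⟨k, _, rfl⟩; exact Submodule.smul_mem _ _ (hgC k)
    · rw [← hP, Submodule.span_le]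
      rintro _ ⟨⟨j, k⟩, hp, rfl⟩
      have := hv j k
      rw [if_pos (Finset.mem_coe.1 hp)] at this
      rw [← this]
      exact Submodule.smul_mem _ _ (Submodule.subset_span ⟨k, trivial, rfl⟩)
  have hvirr : ∀ k ∈ Set.univ, Submodule.span R (v '' (Set.univ \ {k})) ≠ C := by
    intro k _ h
    apply hgirr k
    apply le_antisymm
    · rw [Submodule.span_le]; rintro _ ⟨m, _, rfl⟩; exact hgC m
    · rw [← h, Submodule.span_le]
      rintro _ ⟨m, hm, rfl⟩
      exact Submodule.smul_mem _ _ (Submodule.subset_span ⟨m, hm.2, rfl⟩)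
  obtain ⟨hv1, hv2⟩ := isMinGenSet_image v Set.univ C hvs hvirr
  obtain ⟨hp1, hp2⟩ := isMinGenSet_image (hom g) (P : Set _) C hP hPirr
  have hcard : (hom g '' (P : Set (Fin ℓ × Fin i))).ncard = P.card := by
    rw [Set.ncard_image_of_injOn hp2, Set.ncard_coe_finset]
  refine ⟨v, Set.injOn_univ.1 hv2, by rwa [← Set.image_univ], ?_⟩
  rw [hV, hcard]
  refine ⟨hp1, ?_, (card_eq_Mnum C g P hP hPirr).symm, P.finite_toSet.image _⟩
  have hex : ∀ k, ∃ j, (j, k) ∈ P := by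
    intro k
    by_contra! hk
    apply hgirr k
    apply le_antisymm
    · rw [Submodule.span_le]; rintro _ ⟨m, _, rfl⟩; exact hgC m
    · rw [← hP, Submodule.span_le]
      rintro _ ⟨⟨j, m⟩, hm, rfl⟩
      refine Submodule.smul_mem _ _ (Submodule.subset_span ⟨m, ?_, rfl⟩)
      rintro rfl
      exact hk j hm
  choose f hf using hex
  have := Finset.card_le_card_of_injOn (s := (Finset.univ : Finset (Fin i))) (t := P)
    (fun k => (f k, k)) (fun k _ => hf k) (fun a _ b _ h => (Prod.ext_iff.1 h).2)
  simpa using this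

/-- Theorem `lem:minspecial`: for a nonzero code `C ⊆ R^n` over a product
`R = R_1 × … × R_ℓ` of finite local rings having a minimal system of generators of
cardinality `i`: (a) there are minimal generators `v_1,…,v_i` such that
`V = {e_j • v_k ≠ 0}` is a minimal system of generators of `C` with `|V| ≥ i`;
(b) `M(C)` is the largest cardinality of a minimal system of generators of `C`. -/
theorem stmt_0 {ℓ n : ℕ} {Rj : Fin ℓ → Type*} [∀ j, CommRing (Rj j)] [∀ j, Fintype (Rj j)]
    [∀ j, IsLocalRing (Rj j)]
    (C : Submodule (∀ j, Rj j) (Fin n → ∀ j, Rj j)) (hC : C ≠ ⊥)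
    (i : ℕ) (G : Finset (Fin n → ∀ j, Rj j)) (hGcard : G.card = i)
    (hGmin : IsMinGenSet (∀ j, Rj j) (↑G : Set (Fin n → ∀ j, Rj j)) C) :
    (∃ v : Fin i → (Fin n → ∀ j, Rj j), Function.Injective v ∧
      IsMinGenSet (∀ j, Rj j) (Set.range v) C ∧
      IsMinGenSet (∀ j, Rj j)
        {w | w ≠ 0 ∧ ∃ (j : Fin ℓ) (k : Fin i), w = (Pi.single j 1 : ∀ m, Rj m) • v k} C ∧
      i ≤ {w | w ≠ 0 ∧ ∃ (j : Fin ℓ) (k : Fin i),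
            w = (Pi.single j 1 : ∀ m, Rj m) • v k}.ncard) ∧
    Mnum C = sSup {m | ∃ H : Finset (Fin n → ∀ j, Rj j), H.card = m ∧
      IsMinGenSet (∀ j, Rj j) (↑H : Set (Fin n → ∀ j, Rj j)) C} := by
  classical
  obtain ⟨v, h1, h2, h3, h4, h5, h6⟩ := partA C i G hGcard hGmin
  refine ⟨⟨v, h1, h2, h3, h4⟩, ?_⟩
  symm
  apply IsGreatest.csSup_eq
  constructor
  · refine ⟨h6.toFinset, ?_, by rwa [Set.Finite.coe_toFinset]⟩
    rw [← h5, Set.ncard_eq_toFinset_card _ h6]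
  · rintro m ⟨H, hH, hHmin⟩
    obtain ⟨v', -, -, -, h4', h5', -⟩ := partA C m H hH hHmin
    exact h4'.trans h5'.le
end

section
/- Let R = R_1 × … × R_ℓ be a product of finite local rings with Jacobson radical J, and let D ⊆ C ⊆ 0:_{R^n} J be R-linear codes. Then M(D) ≤ M(C), and M(D) = M(C) if and only if D = C. -/
lemma mu_eq_spanFinrank (R : Type*) {M : Type*} [Semiring R] [AddCommMonoid M] [Module R M]
    (D : Submodule R M) : mu R D = D.spanFinrank := by
  rw [Submodule.spanFinrank_eq_iInf, mu, iInf]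
  congr 1
  ext k
  constructor
  · rintro ⟨s, h1, h2⟩
    exact ⟨⟨s, h2⟩, h1⟩
  · rintro ⟨⟨s, h2⟩, h1⟩
    exact ⟨s, h1, h2⟩

lemma card_eq_pow_mu {R M : Type*} [CommRing R] [Finite R] [IsLocalRing R] [AddCommGroup M]
    [Module R M] [Finite M] (N : Submodule R M)
    (hN : ∀ r ∈ IsLocalRing.maximalIdeal R, ∀ v ∈ N, r • v = 0) :
    Nat.card N = Nat.card (R ⧸ IsLocalRing.maximalIdeal R) ^ mu R N := by
  have hbot : IsLocalRing.maximalIdeal R • (⊤ : Submodule R N) = ⊥ := by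
    rw [eq_bot_iff, Submodule.smul_le]
    rintro r hr ⟨v, hv⟩ -
    rw [Submodule.mem_bot]
    ext
    exact hN r hr v hv
  rw [mu_eq_spanFinrank, IsLocalRing.spanFinrank_eq_finrank_quotient N
    (Submodule.FG.of_finite)]
  let : Field (R ⧸ IsLocalRing.maximalIdeal R) := Ideal.Quotient.field _
  have : Finite (N ⧸ IsLocalRing.maximalIdeal R • (⊤ : Submodule R N)) :=
    Finite.of_surjective _ (Submodule.mkQ_surjective _)
  have h := Module.natCard_eq_pow_finrank (K := R ⧸ IsLocalRing.maximalIdeal R)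
    (V := N ⧸ IsLocalRing.maximalIdeal R • (⊤ : Submodule R N))
  rw [← h]
  exact Nat.card_congr (Submodule.quotEquivOfEqBot _ hbot).symm.toEquiv

lemma mu_mono_and_eq {R M : Type*} [CommRing R] [Finite R] [IsLocalRing R] [AddCommGroup M]
    [Module R M] [Finite M] (N K : Submodule R M) (hNK : N ≤ K)
    (hK : ∀ r ∈ IsLocalRing.maximalIdeal R, ∀ v ∈ K, r • v = 0) :
    mu R N ≤ mu R K ∧ (mu R N = mu R K → N = K) := by
  have h1 := card_eq_pow_mu K hK
  have h2 := card_eq_pow_mu N (fun r hr v hv => hK r hr v (hNK hv))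
  have : Finite (R ⧸ IsLocalRing.maximalIdeal R) :=
    Finite.of_surjective _ Ideal.Quotient.mk_surjective
  have hq : 1 < Nat.card (R ⧸ IsLocalRing.maximalIdeal R) := Finite.one_lt_card
  constructor
  · rw [← Nat.pow_le_pow_iff_right hq, ← h1, ← h2]
    exact Nat.card_mono (Set.toFinite (K : Set M)) hNK
  · intro h
    apply SetLike.coe_injective
    apply Set.eq_of_subset_of_ncard_le hNK _ (Set.toFinite _)
    rw [← h, ← h2] at h1
    exact h1.le

lemma mem_projCode {ℓ n : ℕ} {Rj : Fin ℓ → Type*} [∀ j, CommRing (Rj j)]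
    (C : Submodule (∀ j, Rj j) (Fin n → ∀ j, Rj j)) (j : Fin ℓ) (w : Fin n → Rj j) :
    w ∈ projCode C j ↔ ∃ v ∈ C, w = fun i => v i j := by
  constructor
  · intro hw
    induction hw using Submodule.span_induction with
    | mem x h => exact h
    | zero => exact ⟨0, C.zero_mem, rfl⟩
    | add x y _ _ hx hy =>
      obtain ⟨a, ha, rfl⟩ := hx
      obtain ⟨b, hb, rfl⟩ := hy
      exact ⟨a + b, C.add_mem ha hb, rfl⟩
    | smul r x _ hx =>
      obtain ⟨a, ha, rfl⟩ := hx
      refine ⟨(Pi.single j r : ∀ j, Rj j) • a, C.smul_mem _ ha, ?_⟩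
      ext i
      simp
  · intro h
    exact Submodule.subset_span h

lemma single_mem_jacobson {ℓ : ℕ} {Rj : Fin ℓ → Type*} [∀ j, CommRing (Rj j)]
    [∀ j, IsLocalRing (Rj j)] (j : Fin ℓ) (r : Rj j) (hr : r ∈ IsLocalRing.maximalIdeal (Rj j)) :
    (Pi.single j r : ∀ j, Rj j) ∈ (⊥ : Ideal (∀ j, Rj j)).jacobson := by
  rw [Ideal.mem_jacobson_bot]
  intro y
  rw [Pi.isUnit_iff]
  intro k
  by_cases hk : k = j
  · subst hk
    have : r ∈ (⊥ : Ideal (Rj k)).jacobson := by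
      rwa [IsLocalRing.jacobson_eq_maximalIdeal _ bot_ne_top]
    simpa using Ideal.mem_jacobson_bot.1 this (y k)
  · simp [Pi.single_eq_of_ne hk]

/-- Proposition `lem:equal`: if `D ⊆ C ⊆ 0:_{R^n} J` are codes over a
product `R = R_1 × … × R_ℓ` of finite local rings with Jacobson radical `J`, then
`M(D) ≤ M(C)`, with equality if and only if `D = C`. -/
theorem stmt_1 {ℓ n : ℕ} {Rj : Fin ℓ → Type*} [∀ j, CommRing (Rj j)] [∀ j, Fintype (Rj j)]
    [∀ j, IsLocalRing (Rj j)]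
    (C D : Submodule (∀ j, Rj j) (Fin n → ∀ j, Rj j)) (hDC : D ≤ C)
    (hCJ : ∀ v ∈ C, ∀ r ∈ (⊥ : Ideal (∀ j, Rj j)).jacobson,
      r • v = (0 : Fin n → ∀ j, Rj j)) :
    Mnum D ≤ Mnum C ∧ (Mnum D = Mnum C ↔ D = C) := by
  classical
  have hle : ∀ j, projCode D j ≤ projCode C j := fun j w hw => by
    rw [mem_projCode] at hw ⊢
    obtain ⟨v, hv, rfl⟩ := hw
    exact ⟨v, hDC hv, rfl⟩
  have hkill : ∀ j, ∀ r ∈ IsLocalRing.maximalIdeal (Rj j), ∀ w ∈ projCode C j, r • w = 0 := by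
    intro j r hr w hw
    rw [mem_projCode] at hw
    obtain ⟨v, hv, rfl⟩ := hw
    ext i
    have := congrFun (congrFun (hCJ v hv _ (single_mem_jacobson j r hr)) i) j
    simpa using this
  have hmain := fun j => mu_mono_and_eq _ _ (hle j) (hkill j)
  refine ⟨Finset.sum_le_sum fun j _ => (hmain j).1, ?_, fun h => by rw [h]⟩
  intro h
  have hj := (Finset.sum_eq_sum_iff_of_le (fun j _ => (hmain j).1)).1 h
  refine le_antisymm hDC fun v hv => ?_
  have hex : ∀ j, ∃ u ∈ D, (fun i => v i j) = fun i => u i j := fun j => by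
    rw [← mem_projCode, (hmain j).2 (hj j (Finset.mem_univ j)), mem_projCode]
    exact ⟨v, hv, rfl⟩
  choose u hu huv using hex
  have hv' : v = ∑ j, (Pi.single j 1 : ∀ j, Rj j) • u j := by
    ext i k
    rw [Finset.sum_apply, Finset.sum_apply, Finset.sum_eq_single k]
    · simpa using congrFun (huv k) i
    · intro b _ hb
      simp [Pi.single_eq_of_ne hb.symm]
    · simp
  rw [hv']
  exact D.sum_mem fun j _ => D.smul_mem _ (hu j)
end

section
/- Let R = R_1 × … × R_ℓ be a product of finite local rings and let σ : R^n → ℕ^u be a modular support. Then for every coordinate x ∈ {1,…,u} there is at most one index j ∈ {1,…,ℓ} such that σ(e_j·v)_x ≠ 0 for some v ∈ R^n; that is, for all distinct i, j ∈ {1,…,ℓ}, all v, w ∈ R^n and all x ∈ {1,…,u}, either σ(e_i·v)_x = 0 or σ(e_j·w)_x = 0. (Consequently, up to a permutation of the coordinates of ℕ^u, σ decomposes as a product σ_1 × … × σ_ℓ of modular supports σ_j on R_j^n.) -/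
theorem stmt_5_aux {R : Type*} [CommRing R] {n u : ℕ} (σ : (Fin n → R) → Fin u → ℕ)
    (hσ : IsSupport σ) (hmod : IsModular σ) (e f : R) (he : e * e = e) (hef : e * f = 0)
    (v w : Fin n → R) (x : Fin u) (h0 : σ (e • v) x ≠ 0) (hle : σ (e • v) x ≤ σ (f • w) x) :
    False := by
  obtain ⟨r, hr⟩ := hmod _ _ x h0 hle
  have h1 := hσ.2.1 e (e • v + r • f • w) x
  have h2 : e • (e • v + r • f • w) = e • v := by
    rw [smul_add, smul_smul, he, smul_smul, smul_smul,
      show e * r * f = 0 by rw [mul_right_comm, hef, zero_mul], zero_smul, add_zero]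
  rw [h2] at h1
  exact absurd h1 (not_le.mpr hr)

/-- from Theorem `thm:supp*`: for a modular support `σ` on `R^n` over a
product `R = R_1 × … × R_ℓ` of finite local rings, each coordinate `x` of `ℕ^u` is "used"
by at most one factor: for distinct `i, j`, all `v, w` and all `x`, either
`σ(e_i • v)_x = 0` or `σ(e_j • w)_x = 0`. -/
theorem stmt_5 {ℓ n u : ℕ} {Rj : Fin ℓ → Type*} [∀ j, CommRing (Rj j)] [∀ j, Fintype (Rj j)]
    [∀ j, IsLocalRing (Rj j)]
    (σ : (Fin n → ∀ j, Rj j) → Fin u → ℕ) (hσ : IsSupport σ) (hmod : IsModular σ) :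
    ∀ i j : Fin ℓ, i ≠ j → ∀ (v w : Fin n → ∀ k, Rj k) (x : Fin u),
      σ ((Pi.single i 1 : ∀ k, Rj k) • v) x = 0 ∨
      σ ((Pi.single j 1 : ∀ k, Rj k) • w) x = 0 := by
  intro i j hij v w x
  by_contra! h
  have hs : ∀ k : Fin ℓ, (Pi.single k 1 : ∀ k, Rj k) * Pi.single k 1 = Pi.single k 1 := by
    intro k
    rw [← Pi.single_mul, mul_one]
  have ho : ∀ k m : Fin ℓ, k ≠ m → (Pi.single k 1 : ∀ k, Rj k) * Pi.single m 1 = 0 := by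
    intro k m hkm
    ext t
    by_cases h1 : t = k
    · subst h1
      simp [Pi.single_eq_of_ne hkm]
    · simp [Pi.single_eq_of_ne h1]
  rcases le_total (σ ((Pi.single i 1 : ∀ k, Rj k) • v) x)
      (σ ((Pi.single j 1 : ∀ k, Rj k) • w) x) with hle | hle
  · exact stmt_5_aux σ hσ hmod _ _ (hs i) (ho i j hij) v w x h.1 hle
  · exact stmt_5_aux σ hσ hmod _ _ (hs j) (ho j i hij.symm) w v x h.2 hle
end

section
/- Let R be a finite commutative ring with Jacobson radical J and let σ : R^n → ℕ^u be a modular support. If v, w ∈ 0:_{R^n} J and i ∈ {1,…,u} satisfy σ(v)_i ≠ 0 and σ(w)_i ≠ 0, then there exists a unit r ∈ R with σ(v − r•w)_i = 0. -/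
/-- In a finite monoid some positive power of every element is idempotent. -/
theorem aux_idem {R : Type*} [CommRing R] [Finite R] (a : R) :
    ∃ k : ℕ, a ^ (k + 1) * a ^ (k + 1) = a ^ (k + 1) := by
  obtain ⟨x, y, hxy, h⟩ := Finite.exists_ne_map_eq_of_infinite (fun k : ℕ => a ^ k)
  wlog hlt : x < y generalizing x y
  · exact this y x hxy.symm h.symm (by omega)
  obtain ⟨p, rfl⟩ : ∃ p, y = x + (p + 1) := ⟨y - x - 1, by omega⟩
  have h1 : ∀ t : ℕ, a ^ (x + (p + 1) * t) = a ^ x := by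
    intro t
    induction t with
    | zero => simp
    | succ t ih =>
      rw [show x + (p + 1) * (t + 1) = (x + (p + 1) * t) + (p + 1) by ring, pow_add, ih,
        ← pow_add, ← h]
  refine ⟨(p + 1) * x + p, ?_⟩
  have h2 : (p + 1) * x + p + 1 = x + (p * x + p + 1) := by ring
  rw [← pow_add, show (p + 1) * x + p + 1 + ((p + 1) * x + p + 1)
    = (x + (p + 1) * (x + 1)) + (p * x + p + 1) by ring, pow_add, h1, ← pow_add, h2]

/-- The vectors whose `i`-th support component vanishes. -/
def zeroSub {R : Type*} [CommRing R] {n u : ℕ} (σ : (Fin n → R) → Fin u → ℕ)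
    (hσ : IsSupport σ) (i : Fin u) : Submodule R (Fin n → R) where
  carrier := {v | σ v i = 0}
  zero_mem' := by
    have := (hσ.1 0).2 rfl
    simp [this]
  add_mem' := by
    intro a b ha hb
    have := hσ.2.2 a b i
    simp only [Set.mem_ofPred_eq, Pi.sup_apply] at *
    rw [ha, hb] at this
    simpa using this
  smul_mem' := by
    intro r a ha
    have := hσ.2.1 r a i
    simp only [Set.mem_ofPred_eq] at *
    omega

theorem aux_mod {R : Type*} [CommRing R] {n u : ℕ} (σ : (Fin n → R) → Fin u → ℕ)
    (hmod : IsModular σ) (i : Fin u) (w : Fin n → R) :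
    ∀ (m : ℕ) (v : Fin n → R), σ v i ≤ m → σ v i ≤ σ w i → ∃ r : R, σ (v - r • w) i = 0 := by
  intro m
  induction m with
  | zero => intro v hv _; exact ⟨0, by simpa using hv⟩
  | succ m ih =>
    intro v hv hvw
    by_cases h0 : σ v i = 0
    · exact ⟨0, by simpa using h0⟩
    obtain ⟨r, hr⟩ := hmod v w i h0 hvw
    obtain ⟨s, hs⟩ := ih (v + r • w) (by omega) (by omega)
    refine ⟨s - r, ?_⟩
    rw [← hs]
    congr 1
    module

theorem aux_main {R : Type*} [CommRing R] [Finite R] {n u : ℕ}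
    (σ : (Fin n → R) → Fin u → ℕ) (hσ : IsSupport σ) (hmod : IsModular σ)
    (v w : Fin n → R)
    (hw : ∀ r ∈ (⊥ : Ideal R).jacobson, r • w = (0 : Fin n → R))
    (i : Fin u) (hvi : σ v i ≠ 0) (hle : σ v i ≤ σ w i) :
    ∃ r : R, IsUnit r ∧ v - r • w ∈ zeroSub σ hσ i := by
  obtain ⟨a, ha⟩ := aux_mod σ hmod i w _ v le_rfl hle
  obtain ⟨k, hk⟩ := aux_idem a
  set N := zeroSub σ hσ i with hN
  have hv' : v ∉ N := hvi
  have ha' : v - a • w ∈ N := ha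
  obtain ⟨e, he⟩ : ∃ e, e = a ^ (k + 1) := ⟨_, rfl⟩
  rw [← he] at hk
  have hnil : (a * (1 - e)) • w = 0 := by
    apply hw
    apply Ideal.radical_le_jacobson
    refine ⟨k + 1, ?_⟩
    have h1 : (1 - e) ^ (k + 1) = 1 - e := by
      apply IsIdempotentElem.pow_succ_eq
      show (1 - e) * (1 - e) = 1 - e
      linear_combination hk
    rw [mul_pow, h1, ← he, Ideal.mem_bot]
    linear_combination -hk
  have hew : e • w ∉ N := by
    intro h
    apply hv'
    have h2 : v = (v - a • w) + (a * (1 - e)) • w + a • (e • w) := by module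
    rw [h2, hnil]
    exact N.add_mem (N.add_mem ha' N.zero_mem) (N.smul_mem _ h)
  have hfw : (1 - e) • w ∈ N := by
    rcases le_total (σ (e • w) i) (σ ((1 - e) • w) i) with h | h
    · exfalso
      obtain ⟨s, hs⟩ := aux_mod σ hmod i _ _ (e • w) le_rfl h
      have hs' : e • w - s • (1 - e) • w ∈ N := hs
      have := N.smul_mem e hs'
      apply hew
      convert this using 1
      simp only [smul_sub, smul_smul]
      rw [show e * (s * (1 - e)) = 0 by linear_combination -s * hk, hk]
      simp
    · obtain ⟨s, hs⟩ := aux_mod σ hmod i _ _ ((1 - e) • w) le_rfl h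
      have hs' : (1 - e) • w - s • e • w ∈ N := hs
      have := N.smul_mem (1 - e) hs'
      convert this using 1
      simp only [smul_sub, smul_smul]
      rw [show (1 - e) * (s * e) = 0 by linear_combination -s * hk,
        show (1 - e) * (1 - e) = 1 - e by linear_combination hk]
      simp
  refine ⟨a * e + (1 - e), ?_, ?_⟩
  · apply IsUnit.of_mul_eq_one (a ^ k * e + (1 - e))
    have h3 : a * a ^ k = e := by rw [he]; ring
    linear_combination (e * e) * h3 + (e - a - a ^ k + 2) * hk
  · have h2 : v - (a * e + (1 - e)) • w
        = (v - a • w) + a • ((1 - e) • w) - (1 - e) • w := by module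
    rw [h2]
    exact N.sub_mem (N.add_mem ha' (N.smul_mem _ hfw)) hfw

/-- Corollary `lemadd`: for a modular support `σ` over a finite commutative
ring `R` with Jacobson radical `J`, if `v, w ∈ 0:_{R^n} J` and `σ(v)_i ≠ 0 ≠ σ(w)_i`, then
there is a unit `r ∈ R` with `σ(v - r•w)_i = 0`. -/
theorem stmt_6 {R : Type*} [CommRing R] [Fintype R] [Nontrivial R] {n u : ℕ}
    (σ : (Fin n → R) → Fin u → ℕ) (hσ : IsSupport σ) (hmod : IsModular σ)
    (v w : Fin n → R)
    (hv : ∀ r ∈ (⊥ : Ideal R).jacobson, r • v = (0 : Fin n → R))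
    (hw : ∀ r ∈ (⊥ : Ideal R).jacobson, r • w = (0 : Fin n → R))
    (i : Fin u) (hvi : σ v i ≠ 0) (hwi : σ w i ≠ 0) :
    ∃ r : R, IsUnit r ∧ σ (v - r • w) i = 0 := by
  rcases le_total (σ v i) (σ w i) with h | h
  · exact aux_main σ hσ hmod v w hw i hvi h
  · obtain ⟨r, ⟨r, rfl⟩, hr⟩ := aux_main σ hσ hmod w v hv i hwi h
    refine ⟨↑r⁻¹, r⁻¹.isUnit, ?_⟩
    have h1 := (zeroSub σ hσ i).smul_mem (-(↑r⁻¹ : R)) hr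
    have h2 : v - (↑r⁻¹ : R) • w = (-(↑r⁻¹ : R)) • (w - (r : R) • v) := by
      rw [smul_sub, smul_smul, neg_mul, Units.inv_mul]
      module
    rw [h2]
    exact h1
end

section
/- Let R be a finite commutative ring, let σ : R^n → {0,1}^u be a modular support (identifying each element of {0,1}^u with a subset of {1,…,u}), and let 0 ≠ C ⊆ R^n be an R-linear code. Then the family 𝒞 := { σ(v) : v ∈ Min(C) } of subsets of {1,…,u} satisfies the circuit axioms of a matroid: (C1) ∅ ∉ 𝒞; (C2) if A, B ∈ 𝒞 and A ⊆ B, then A = B; (C3) if A, B ∈ 𝒞 are distinct and i ∈ A ∩ B, then there exists Z ∈ 𝒞 with Z ⊆ (A ∪ B) \ {i}. -/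
/-- for a modular support `σ : R^n → {0,1}^u` and a nonzero code
`C ⊆ R^n`, the supports of the minimal codewords of `C` (viewed as subsets of `{1,…,u}`)
satisfy the circuit axioms (C1), (C2), (C3) of a matroid. -/
theorem stmt_7 {R : Type*} [CommRing R] [Fintype R] [Nontrivial R] {n u : ℕ}
    (σ : (Fin n → R) → Fin u → ℕ) (hσ : IsSupport σ) (hmod : IsModular σ)
    (hbin : ∀ v i, σ v i ≤ 1)
    (C : Submodule R (Fin n → R)) (hC : C ≠ ⊥)
    (𝒞 : Set (Set (Fin u)))
    (h𝒞 : 𝒞 = {A | ∃ v ∈ MinSet σ (C : Set (Fin n → R)), A = {i | σ v i ≠ 0}}) :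
    (∅ ∉ 𝒞) ∧
    (∀ A ∈ 𝒞, ∀ B ∈ 𝒞, A ⊆ B → A = B) ∧
    (∀ A ∈ 𝒞, ∀ B ∈ 𝒞, A ≠ B → ∀ i ∈ A ∩ B, ∃ Z ∈ 𝒞, Z ⊆ (A ∪ B) \ {i}) := by
  obtain ⟨h1, h2, h3⟩ := hσ
  subst h𝒞
  have le_of : ∀ v w, {i | σ v i ≠ 0} ⊆ {i | σ w i ≠ 0} → σ v ≤ σ w := by
    intro v w h i
    change σ v i ≤ σ w i
    have ha : σ v i ≤ 1 := hbin v i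
    by_cases h0 : σ v i = 0
    · omega
    · have hb : σ w i ≠ 0 := h h0
      omega
  have exmin : ∀ x ∈ C, x ≠ 0 → ∃ z ∈ MinSet σ (C : Set (Fin n → R)), σ z ≤ σ x := by
    intro x hx hx0
    obtain ⟨z, ⟨hzC, hz0, hzx⟩, hmin⟩ :=
      (Set.toFinite {w | w ∈ C ∧ w ≠ 0 ∧ σ w ≤ σ x}).exists_minimalFor σ _
        ⟨x, hx, hx0, le_refl _⟩
    exact ⟨z, ⟨hzC, hz0, fun w hw hw0 hwz =>
      le_antisymm hwz (hmin ⟨hw, hw0, hwz.trans hzx⟩ hwz)⟩, hzx⟩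
  refine ⟨?_, ?_, ?_⟩
  · rintro ⟨v, ⟨_, hv0, _⟩, he⟩
    apply hv0
    rw [← h1]
    funext i
    by_contra hi
    have hmem : i ∈ {i | σ v i ≠ 0} := hi
    rw [← he] at hmem
    exact hmem
  · rintro A ⟨v, ⟨hvC, hv0, _⟩, rfl⟩ B ⟨w, ⟨_, _, hw⟩, rfl⟩ hAB
    rw [hw v hvC hv0 (le_of v w hAB)]
  · rintro A ⟨v, ⟨hvC, hv0, _⟩, rfl⟩ B ⟨w, ⟨hwC, _, hw⟩, rfl⟩ hne i ⟨hiv, hiw⟩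
    have hiv' : σ v i ≠ 0 := hiv
    have hiw' : σ w i ≠ 0 := hiw
    have hbv := hbin v i
    obtain ⟨r, hr⟩ := hmod v w i hiv' (by omega)
    have hx0 : v + r • w ≠ 0 := by
      intro h
      apply hne
      have hv : v = (-r) • w := by
        rw [neg_smul]
        exact eq_neg_of_add_eq_zero_left h
      have hle : σ v ≤ σ w := by
        rw [hv]
        exact h2 _ _
      rw [hw v hvC hv0 hle]
    obtain ⟨z, hz, hzx⟩ := exmin _ (C.add_mem hvC (C.smul_mem r hwC)) hx0
    refine ⟨_, ⟨z, hz, rfl⟩, ?_⟩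
    intro j hj
    have hj' : σ z j ≠ 0 := hj
    have a1 : σ z j ≤ σ (v + r • w) j := hzx j
    have a2 : σ (v + r • w) j ≤ max (σ v j) (σ (r • w) j) := h3 v (r • w) j
    have a3 : σ (r • w) j ≤ σ w j := h2 r w j
    refine ⟨?_, ?_⟩
    · change σ v j ≠ 0 ∨ σ w j ≠ 0
      omega
    · rintro rfl
      omega
end

section
/- Let R = R_1 × … × R_ℓ be a product of finite local rings with Jacobson radical J, let σ : R^n → ℕ^u be a modular support, and let C ⊆ R^n be an R-linear code. If v ∈ Min(C), then there exists j ∈ {1,…,ℓ} such that v = e_j·v and π_j(v) ∈ Min(C_j); moreover v ∈ 0:_C J. In particular Min(C) ⊆ 0:_C J and Min(C) = Min(0:_C J). -/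
theorem aux_smul {R : Type*} [CommRing R] {n u : ℕ} (σ : (Fin n → R) → Fin u → ℕ)
    (hσ : IsSupport σ) (hmod : IsModular σ) (C : Submodule R (Fin n → R))
    (v : Fin n → R) (hv : v ∈ MinSet σ (C : Set (Fin n → R))) (r : R) (hr : r • v ≠ 0) :
    ∃ s : R, v + s • r • v = 0 := by
  obtain ⟨hvC, hv0, hmin⟩ := hv
  obtain ⟨h1, h2, h3⟩ := hσ
  have heq := hmin (r • v) (C.smul_mem r hvC) hr (h2 r v)
  have hne : σ v ≠ 0 := fun h => hv0 ((h1 v).1 h)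
  obtain ⟨i, hi⟩ := Function.ne_iff.1 hne
  obtain ⟨s, hs⟩ := hmod v (r • v) i hi (by rw [heq])
  refine ⟨s, ?_⟩
  by_contra hcon
  have hle : σ (v + s • r • v) ≤ σ v := by
    have : v + s • r • v = (1 + s * r) • v := by rw [add_smul, one_smul, mul_smul]
    rw [this]
    exact h2 _ _
  have := hmin _ (C.add_mem hvC (C.smul_mem s (C.smul_mem r hvC))) hcon hle
  rw [this] at hs
  exact lt_irrefl _ hs

theorem aux_jac {R : Type*} [CommRing R] {n u : ℕ} (σ : (Fin n → R) → Fin u → ℕ)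
    (hσ : IsSupport σ) (hmod : IsModular σ) (C : Submodule R (Fin n → R))
    (v : Fin n → R) (hv : v ∈ MinSet σ (C : Set (Fin n → R))) (r : R)
    (hr : r ∈ (⊥ : Ideal R).jacobson) : r • v = 0 := by
  by_contra hcon
  obtain ⟨s, hs⟩ := aux_smul σ hσ hmod C v hv r hcon
  have hu : IsUnit (r * s + 1) := Ideal.mem_jacobson_bot.1 hr s
  have h0 : (r * s + 1) • v = 0 := by
    rw [add_smul, one_smul, mul_comm, mul_smul, add_comm]
    exact hs
  exact hv.2.1 (hu.smul_eq_zero.1 h0)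

theorem aux_exists {M : Type*} [Zero M] {u : ℕ} (σ : M → Fin u → ℕ) (S : Set M)
    (w : M) (hw : w ∈ S) (hw0 : w ≠ 0) : ∃ x ∈ MinSet σ S, σ x ≤ σ w := by
  have wf : WellFounded (InvImage (· < ·) σ) :=
    InvImage.wf σ (wellFounded_lt (α := Fin u → ℕ))
  obtain ⟨x, ⟨hxS, hx0, hxw⟩, hx⟩ :=
    wf.has_min {x | x ∈ S ∧ x ≠ 0 ∧ σ x ≤ σ w} ⟨w, hw, hw0, le_refl _⟩
  refine ⟨x, ⟨hxS, hx0, fun y hy hy0 hyx => ?_⟩, hxw⟩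
  by_contra hne
  exact hx y ⟨hy, hy0, hyx.trans hxw⟩ (lt_of_le_of_ne hyx hne)

/-- Theorem `lemma:minsupp`(1),(2): over a product `R = R_1 × … × R_ℓ` of
finite local rings with Jacobson radical `J`, for a modular support `σ` and a code
`C ⊆ R^n`: every minimal codeword `v` of `C` satisfies `v = e_j • v` for some `j`, its
`j`-th projection is a minimal codeword of `C_j` (w.r.t. the induced support), and
`v ∈ 0:_C J`; moreover `Min(C) = Min(0:_C J)`. -/
theorem stmt_8 {ℓ n u : ℕ} {Rj : Fin ℓ → Type*} [∀ j, CommRing (Rj j)] [∀ j, Fintype (Rj j)]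
    [∀ j, IsLocalRing (Rj j)]
    (σ : (Fin n → ∀ j, Rj j) → Fin u → ℕ) (hσ : IsSupport σ) (hmod : IsModular σ)
    (C : Submodule (∀ j, Rj j) (Fin n → ∀ j, Rj j)) :
    (∀ v ∈ MinSet σ (C : Set (Fin n → ∀ j, Rj j)), ∃ j : Fin ℓ,
      (Pi.single j 1 : ∀ k, Rj k) • v = v ∧
      (fun i => v i j) ∈ MinSet (fun w : Fin n → Rj j => σ (fun i => Pi.single j (w i)))
        {w : Fin n → Rj j | ∃ x ∈ C, w = fun i => x i j} ∧
      (∀ r ∈ (⊥ : Ideal (∀ k, Rj k)).jacobson, r • v = (0 : Fin n → ∀ k, Rj k))) ∧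
    MinSet σ (C : Set (Fin n → ∀ j, Rj j)) =
      MinSet σ {v | v ∈ C ∧ ∀ r ∈ (⊥ : Ideal (∀ k, Rj k)).jacobson,
        r • v = (0 : Fin n → ∀ k, Rj k)} := by
  have hproj : ∀ (j : Fin ℓ) (x : Fin n → ∀ j, Rj j),
      (fun i => Pi.single j (x i j)) = (Pi.single j 1 : ∀ k, Rj k) • x := by
    intro j x
    funext i k
    by_cases h : k = j
    · subst h
      simp
    · simp [h]
  refine ⟨fun v hv => ?_, ?_⟩
  · have hv0 := hv.2.1
    obtain ⟨i, hi⟩ := Function.ne_iff.1 hv0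
    obtain ⟨j, hj⟩ := Function.ne_iff.1 hi
    have hej : (Pi.single j 1 : ∀ k, Rj k) • v ≠ 0 := by
      intro h
      apply hj
      have := congrFun (congrFun h i) j
      simpa using this
    obtain ⟨s, hs⟩ := aux_smul σ hσ hmod C v hv _ hej
    have hev : (Pi.single j 1 : ∀ k, Rj k) • v = v := by
      funext i k
      by_cases h : k = j
      · subst h
        simp
      · have := congrFun (congrFun hs i) k
        simp [h] at this
        simp [h, this]
    refine ⟨j, hev, ⟨⟨v, hv.1, rfl⟩, ?_, ?_⟩, fun r hr => aux_jac σ hσ hmod C v hv r hr⟩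
    · intro h
      exact hj (congrFun h i)
    · rintro w ⟨x, hx, rfl⟩ hw0 hle
      simp only [hproj, hev] at hle ⊢
      refine hv.2.2 _ (C.smul_mem _ hx) ?_ hle
      intro h
      apply hw0
      funext i
      have := congrFun (congrFun h i) j
      simpa using this
  · ext v
    constructor
    · intro hv
      exact ⟨⟨hv.1, fun r hr => aux_jac σ hσ hmod C v hv r hr⟩, hv.2.1,
        fun w hw => hv.2.2 w hw.1⟩
    · rintro ⟨⟨hvC, hvJ⟩, hv0, hmin⟩
      refine ⟨hvC, hv0, fun w hw hw0 hle => ?_⟩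
      obtain ⟨x, hx, hxw⟩ := aux_exists σ (C : Set (Fin n → ∀ j, Rj j)) w hw hw0
      have := hmin x ⟨hx.1, fun r hr => aux_jac σ hσ hmod C x hx r hr⟩ hx.2.1 (hxw.trans hle)
      exact le_antisymm hle (this ▸ hxw)
end

section
/- Let R be a finite commutative ring with Jacobson radical J and let σ : R^n → ℕ^u be a modular support. Let C ⊆ 0:_{R^n} J be an R-linear code and let v ∈ C and i ∈ {1,…,u} with σ(v)_i ≠ 0. Then there exists a minimal codeword w ∈ Min(C) with σ(w) ≤ σ(v) (componentwise) and σ(w)_i ≠ 0. -/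
theorem exists_minimal_of_wellFoundedLT_aux {α : Type*} (f : α → ℕ) (p : α → Prop)
    (h : ∃ x, p x) : ∃ x, p x ∧ ∀ y, p y → f x ≤ f y := by
  obtain ⟨x, hx, hmin⟩ := (measure f).wf.has_min {x | p x} h
  exact ⟨x, hx, fun y hy => not_lt.1 (hmin y hy)⟩

theorem exists_pow_aux {R : Type*} [CommRing R] [Finite R] (r : R) :
    ∃ m : ℕ, r - r ^ (m + 1) * r ∈ (⊥ : Ideal R).jacobson := by
  obtain ⟨a, b, hne, hab⟩ := Finite.exists_ne_map_eq_of_infinite (fun k : ℕ => r ^ k)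
  wlog hlt : a < b generalizing a b
  · exact this b a hne.symm hab.symm (by omega)
  obtain ⟨m, rfl⟩ : ∃ m, b = a + (m + 1) := ⟨b - a - 1, by omega⟩
  refine ⟨m, ?_⟩
  have h0 : r ^ a * (1 - r ^ (m + 1)) = 0 := by
    replace hab : r ^ a = r ^ (a + (m + 1)) := hab
    rw [mul_sub, ← pow_add, ← hab]; simp
  have hn : (r - r ^ (m + 1) * r) ^ (a + 1) = 0 := by
    have : r - r ^ (m + 1) * r = r * (1 - r ^ (m + 1)) := by ring
    rw [this, mul_pow]
    calc r ^ (a + 1) * (1 - r ^ (m + 1)) ^ (a + 1)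
        = (r ^ a * (1 - r ^ (m + 1))) * (r * (1 - r ^ (m + 1)) ^ a) := by ring
      _ = 0 := by rw [h0, zero_mul]
  have hrad : (⊥ : Ideal R).radical ≤ (⊥ : Ideal R).jacobson := Ideal.radical_le_jacobson
  exact hrad ⟨a + 1, by simp [hn]⟩

/-- Lemma `lem:replace`: for a modular support `σ` over a finite
commutative ring `R` with Jacobson radical `J`, a code `C ⊆ 0:_{R^n} J`, `v ∈ C` and
`i` with `σ(v)_i ≠ 0`, there is a minimal codeword `w ∈ Min(C)` with `σ(w) ≤ σ(v)` and
`σ(w)_i ≠ 0`. -/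
theorem stmt_12 {R : Type*} [CommRing R] [Fintype R] [Nontrivial R] {n u : ℕ}
    (σ : (Fin n → R) → Fin u → ℕ) (hσ : IsSupport σ) (hmod : IsModular σ)
    (C : Submodule R (Fin n → R))
    (hCJ : ∀ v ∈ C, ∀ r ∈ (⊥ : Ideal R).jacobson, r • v = (0 : Fin n → R))
    (v : Fin n → R) (hv : v ∈ C) (i : Fin u) (hvi : σ v i ≠ 0) :
    ∃ w ∈ MinSet σ (C : Set (Fin n → R)), σ w ≤ σ v ∧ σ w i ≠ 0 := by
  classical
  obtain ⟨P1, P2, P3⟩ := hσ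
  have P0 : σ 0 = 0 := (P1 0).2 rfl
  -- choose a vector with minimal support
  obtain ⟨v₀, ⟨h0C, h0i, h0v⟩, h0min⟩ :=
    exists_minimal_of_wellFoundedLT_aux (fun x => ∑ j, σ x j)
      (fun x => x ∈ C ∧ σ x i ≠ 0 ∧ σ x ≤ σ v) ⟨v, hv, hvi, le_refl _⟩
  have hmin : ∀ x ∈ C, σ x i ≠ 0 → σ x ≤ σ v₀ → σ x = σ v₀ := by
    intro x hx hxi hle
    by_contra hne
    have h1 := h0min x ⟨hx, hxi, hle.trans h0v⟩
    have h2 : ∑ j, σ x j < ∑ j, σ v₀ j := by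
      obtain ⟨_, j, hj⟩ := Pi.lt_def.1 (lt_of_le_of_ne hle hne)
      exact Finset.sum_lt_sum (fun k _ => hle k) ⟨j, Finset.mem_univ _, hj⟩
    omega
  -- then with minimal cyclic module
  obtain ⟨x, ⟨hxC, hxσ⟩, hxmin⟩ :=
    exists_minimal_of_wellFoundedLT_aux
      (fun x : Fin n → R => ((Submodule.span R {x} : Submodule R _) : Set (Fin n → R)).ncard)
      (fun x => x ∈ C ∧ σ x = σ v₀) ⟨v₀, h0C, rfl⟩
  have hxi : σ x i ≠ 0 := by rw [hxσ]; exact h0i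
  have hsimple : ∀ r : R, r • x ≠ 0 → σ (r • x) = σ x := by
    intro r hr
    obtain ⟨m, hm⟩ := exists_pow_aux r
    have hrx : r • x = r ^ (m + 1) • (r • x) := by
      have := hCJ x hxC _ hm
      rw [sub_smul, mul_smul, sub_eq_zero] at this
      exact this
    set e := r ^ (m + 1) with he
    have hexC : e • x ∈ C := C.smul_mem _ hxC
    by_cases hei : σ (e • x) i = 0
    · exfalso
      have hyi : σ ((1 - e) • x) i ≠ 0 := by
        intro h
        have h3 := P3 (e • x) ((1 - e) • x) i
        rw [← add_smul, add_sub_cancel, one_smul, Pi.sup_apply, hei, h] at h3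
        simp at h3
        exact hxi h3
      have hyC : (1 - e) • x ∈ C := C.smul_mem _ hxC
      have hyσ := hmin _ hyC hyi (hxσ ▸ P2 (1 - e) x)
      have h4 := hxmin _ ⟨hyC, hyσ⟩
      have hsub : ((Submodule.span R {(1 - e) • x} : Submodule R _) : Set (Fin n → R))
          ⊆ (Submodule.span R {x} : Submodule R _) := by
        refine Submodule.span_le.2 ?_
        rintro _ rfl
        exact Submodule.smul_mem _ _ (Submodule.mem_span_singleton_self x)
      have heq := Set.eq_of_subset_of_ncard_le hsub h4 (Set.toFinite _)
      have hxm : x ∈ Submodule.span R {(1 - e) • x} := by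
        rw [← SetLike.mem_coe, heq]
        exact Submodule.mem_span_singleton_self x
      obtain ⟨t, ht⟩ := Submodule.mem_span_singleton.1 hxm
      apply hr
      rw [← ht, smul_comm r t, smul_smul r, mul_comm r, mul_smul, sub_smul, one_smul, ← hrx,
        sub_self, smul_zero]
    · have h5 := hmin _ hexC hei (hxσ ▸ P2 e x)
      refine le_antisymm (P2 r x) ?_
      rw [hxσ, ← h5, he, pow_succ, mul_smul]
      exact P2 _ _
  refine ⟨x, ⟨hxC, ?_, ?_⟩, hxσ ▸ h0v, hxi⟩
  · rintro rfl
    rw [P0] at hxi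
    exact hxi rfl
  intro w hwC hw0 hwx
  by_cases hwi : σ w i = 0
  swap
  · rw [hxσ] at hwx ⊢
    exact hmin w hwC hwi hwx
  exfalso
  obtain ⟨j, hj⟩ : ∃ j, σ w j ≠ 0 := by
    by_contra! h
    exact hw0 ((P1 w).1 (funext h))
  have hjx : σ w j ≤ σ x j := hwx j
  rcases hjx.lt_or_eq with hlt | heq
  · obtain ⟨r, hr⟩ := hmod w x j hj hjx
    have hrx : r • x ≠ 0 := by
      intro h
      rw [h, add_zero] at hr
      exact lt_irrefl _ hr
    have h6 := hsimple r hrx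
    have h7 : σ (w + r • x + (-1 : R) • w) j ≤
        max (σ (w + r • x) j) (σ ((-1 : R) • w) j) := P3 _ _ j
    have h8 : σ ((-1 : R) • w) j ≤ σ w j := P2 (-1 : R) w j
    have h9 : w + r • x + (-1 : R) • w = r • x := by rw [neg_one_smul]; abel
    rw [h9, h6] at h7
    omega
  · obtain ⟨r, hr⟩ := hmod x w j (by omega) heq.ge
    have hyC : x + r • w ∈ C := C.add_mem hxC (C.smul_mem _ hwC)
    have hle : σ (x + r • w) ≤ σ x :=
      (P3 _ _).trans (sup_le le_rfl ((P2 r w).trans hwx))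
    have hyi : σ (x + r • w) i ≠ 0 := by
      intro h
      have h7 : σ (x + r • w + (-r) • w) i ≤
          max (σ (x + r • w) i) (σ ((-r) • w) i) := P3 _ _ i
      have h8 : σ ((-r) • w) i ≤ σ w i := P2 (-r) w i
      have h9 : x + r • w + (-r) • w = x := by rw [neg_smul]; abel
      rw [h9, h] at h7
      omega
    have h10 := hmin _ hyC hyi (hxσ ▸ hle)
    rw [h10, hxσ] at hr
    exact lt_irrefl _ hr
end

section
/- Let R be a finite commutative ring with Jacobson radical J, let σ : R^n → ℕ^u be a modular support, let j ≥ 1, and let C ⊆ 0:_{R^n} J be an R-linear code having a minimal system of generators of cardinality j. Then C has a minimal system of generators {v_1, …, v_j} such that for every i ∈ {1,…,j} there exists an index k_i ∈ {1,…,u} with σ(v_i)_{k_i} ≠ 0 and σ(v_h)_{k_i} = 0 for all h ≠ i. -/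
/-- In a finite commutative ring every element is von Neumann regular modulo the radical. -/
theorem reg_mod_jac {R : Type*} [CommRing R] [Finite R] (r : R) :
    ∃ s : R, r * (1 - r * s) ∈ (⊥ : Ideal R).jacobson := by
  obtain ⟨a, b, hab, h⟩ : ∃ a b : ℕ, a < b ∧ r ^ a = r ^ b := by
    obtain ⟨a, b, hne, h⟩ := Finite.exists_ne_map_eq_of_infinite (fun m : ℕ => r ^ m)
    rcases lt_or_gt_of_ne hne with h1 | h1
    · exact ⟨a, b, h1, h⟩
    · exact ⟨b, a, h1, h.symm⟩
  obtain ⟨c, rfl⟩ := Nat.exists_eq_add_of_lt hab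
  refine ⟨r ^ c, ?_⟩
  have h0 : r ^ a * (1 - r * r ^ c) = 0 := by
    have : r ^ (a + c + 1) = r ^ a * (r * r ^ c) := by ring
    rw [mul_sub, mul_one, ← this, ← h, sub_self]
  have hn : IsNilpotent (r * (1 - r * r ^ c)) := by
    refine ⟨a + 1, ?_⟩
    rw [mul_pow]
    calc _ = (r ^ a * (1 - r * r ^ c)) * (r * (1 - r * r ^ c) ^ a) := by ring
      _ = 0 := by rw [h0, zero_mul]
  rw [Ideal.mem_jacobson_bot]
  intro y
  have : IsNilpotent (r * (1 - r * r ^ c) * y) := by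
    obtain ⟨m, hm⟩ := hn
    exact ⟨m, by rw [mul_pow, hm, zero_mul]⟩
  exact this.isUnit_add_one

/-- The submodule of vectors whose support vanishes at `k`. -/
def NK {R : Type*} [CommRing R] {n u : ℕ} (σ : (Fin n → R) → Fin u → ℕ) (hσ : IsSupport σ)
    (k : Fin u) : Submodule R (Fin n → R) where
  carrier := {v | σ v k = 0}
  zero_mem' := by
    have := (hσ.1 0).2 rfl
    simp [this]
  add_mem' := by
    intro a b ha hb
    have := hσ.2.2 a b k
    simp only [Set.mem_setOf_eq, Pi.sup_apply] at *
    rw [ha, hb] at this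
    simpa using this
  smul_mem' := by
    intro c x hx
    have := hσ.2.1 c x k
    simp only [Set.mem_setOf_eq] at *
    omega

theorem mem_NK {R : Type*} [CommRing R] {n u : ℕ} {σ : (Fin n → R) → Fin u → ℕ}
    {hσ : IsSupport σ} {k : Fin u} {v : Fin n → R} : v ∈ NK σ hσ k ↔ σ v k = 0 := Iff.rfl

theorem red_le {R : Type*} [CommRing R] {n u : ℕ} (σ : (Fin n → R) → Fin u → ℕ)
    (hσ : IsSupport σ) (hmod : IsModular σ) (k : Fin u) (w : Fin n → R) :
    ∀ (m : ℕ) (v : Fin n → R), σ v k = m → m ≤ σ w k → ∃ r : R, v + r • w ∈ NK σ hσ k := by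
  intro m
  induction m using Nat.strong_induction_on with
  | _ m ih =>
    intro v hv hm
    by_cases h0 : m = 0
    · exact ⟨0, by rw [zero_smul, add_zero, mem_NK, hv, h0]⟩
    · obtain ⟨r, hr⟩ := hmod v w k (by omega) (by omega)
      obtain ⟨r', hr'⟩ := ih _ (by omega) (v + r • w) rfl (by omega)
      exact ⟨r + r', by rw [add_smul, ← add_assoc]; exact hr'⟩

theorem red_all {R : Type*} [CommRing R] [Finite R] {n u : ℕ} (σ : (Fin n → R) → Fin u → ℕ)
    (hσ : IsSupport σ) (hmod : IsModular σ) (k : Fin u) (w x : Fin n → R)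
    (hx : ∀ r ∈ (⊥ : Ideal R).jacobson, r • x = 0) (hw : w ∉ NK σ hσ k) :
    ∃ r : R, x + r • w ∈ NK σ hσ k := by
  rcases le_total (σ x k) (σ w k) with h | h
  · exact red_le σ hσ hmod k w _ x rfl h
  obtain ⟨r, hr⟩ := red_le σ hσ hmod k x _ w rfl h
  obtain ⟨s, hs⟩ := reg_mod_jac r
  have h0 := hx _ hs
  set N := NK σ hσ k
  -- `(1 - e) w` lies in `N`
  have hew : (1 - r * s) • w ∈ N := by
    have h1 := N.smul_mem (1 - r * s) hr
    have h2 : (1 - r * s) • (w + r • x) = (1 - r * s) • w + (r * (1 - r * s)) • x := by module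
    rw [h2, h0, add_zero] at h1
    exact h1
  have hy : (1 - r * s) • x ∈ N := by
    rcases le_total (σ ((1 - r * s) • x) k) (σ w k) with h | h
    · obtain ⟨a, ha⟩ := red_le σ hσ hmod k w _ _ rfl h
      have h1 := N.smul_mem (1 - r * s) ha
      have h3 := N.sub_mem h1 (N.smul_mem a hew)
      have h4 : (1 - r * s) • ((1 - r * s) • x + a • w) - a • (1 - r * s) • w
          = (1 - r * s) • x - s • (r * (1 - r * s)) • x := by module
      rw [h4, h0, smul_zero, sub_zero] at h3
      exact h3
    · obtain ⟨a, ha⟩ := red_le σ hσ hmod k _ _ w rfl h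
      exfalso
      apply hw
      have h1 := N.add_mem hew (N.smul_mem (r * s) ha)
      have h4 : (1 - r * s) • w + (r * s) • (w + a • (1 - r * s) • x)
          = w + (s * a) • (r * (1 - r * s)) • x := by module
      rw [h4, h0, smul_zero, add_zero] at h1
      exact h1
  refine ⟨s, ?_⟩
  have h1 := N.add_mem hy (N.smul_mem s hr)
  have h4 : (1 - r * s) • x + s • (w + r • x) = x + s • w := by module
  rwa [h4] at h1

theorem main_ind {R : Type*} [CommRing R] [Finite R] {n u : ℕ} (σ : (Fin n → R) → Fin u → ℕ)
    (hσ : IsSupport σ) (hmod : IsModular σ) (j : ℕ) (C : Submodule R (Fin n → R))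
    (hCJ : ∀ v ∈ C, ∀ r ∈ (⊥ : Ideal R).jacobson, r • v = (0 : Fin n → R))
    (v₀ : Fin j → (Fin n → R)) (hspan : Submodule.span R (Set.range v₀) = C)
    (hess : ∀ i, v₀ i ∉ Submodule.span R (v₀ '' {h | h ≠ i})) (S : Finset (Fin j)) :
    ∃ v : Fin j → (Fin n → R), Submodule.span R (Set.range v) = C ∧
      (∀ i, v i ∉ Submodule.span R (v '' {h | h ≠ i})) ∧
      ∀ i ∈ S, ∃ k : Fin u, v i ∉ NK σ hσ k ∧ ∀ h, h ≠ i → v h ∈ NK σ hσ k := by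
  induction S using Finset.induction_on with
  | empty => exact ⟨v₀, hspan, hess, by simp⟩
  | insert i S hi ih =>
    obtain ⟨v, hv, hve, hvS⟩ := ih
    have hvC : ∀ h, v h ∈ C := fun h => hv ▸ Submodule.subset_span ⟨h, rfl⟩
    have hvi : v i ≠ 0 := fun h => hve i (h ▸ Submodule.zero_mem _)
    obtain ⟨k, hk⟩ : ∃ k, v i ∉ NK σ hσ k := by
      by_contra hcon
      push Not at hcon
      exact hvi ((hσ.1 _).1 (funext hcon))
    choose r hr using fun h => red_all σ hσ hmod k (v i) (v h) (hCJ _ (hvC h)) hk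
    let c : Fin j → R := fun h => if h = i then 0 else r h
    let v' : Fin j → (Fin n → R) := fun h => v h + c h • v i
    have hv'i : v' i = v i := by simp [v', c]
    have hv'k : ∀ h, h ≠ i → v' h ∈ NK σ hσ k := by
      intro h hh
      simpa [v', c, hh] using hr h
    have hback : ∀ h, v h = v' h - c h • v' i := by
      intro h; rw [hv'i]; simp [v']
    have hik : v' i ∉ NK σ hσ k := by rwa [hv'i]
    refine ⟨v', ?_, ?_, ?_⟩
    · rw [← hv]
      apply le_antisymm
      · rw [Submodule.span_le]
        rintro _ ⟨h, rfl⟩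
        exact Submodule.add_mem _ (Submodule.subset_span ⟨h, rfl⟩)
          (Submodule.smul_mem _ _ (Submodule.subset_span ⟨i, rfl⟩))
      · rw [Submodule.span_le]
        rintro _ ⟨h, rfl⟩
        rw [hback h]
        exact Submodule.sub_mem _ (Submodule.subset_span ⟨h, rfl⟩)
          (Submodule.smul_mem _ _ (Submodule.subset_span ⟨i, rfl⟩))
    · intro h hmem
      by_cases hh : h = i
      · subst hh
        refine hik ((Submodule.span_le.2 ?_) hmem)
        rintro _ ⟨l, hl, rfl⟩
        exact hv'k l hl
      · have hisp : v i ∈ Submodule.span R (v '' {l | l ≠ h}) :=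
          Submodule.subset_span ⟨i, fun e => hh e.symm, rfl⟩
        have hle : Submodule.span R (v' '' {l | l ≠ h}) ≤ Submodule.span R (v '' {l | l ≠ h}) := by
          rw [Submodule.span_le]
          rintro _ ⟨l, hl, rfl⟩
          exact Submodule.add_mem _ (Submodule.subset_span ⟨l, hl, rfl⟩)
            (Submodule.smul_mem _ _ hisp)
        apply hve h
        rw [hback h, hv'i]
        exact Submodule.sub_mem _ (hle hmem) (Submodule.smul_mem _ _ hisp)
    · intro s hs
      by_cases hsi : s = i
      · subst hsi
        exact ⟨k, hik, hv'k⟩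
      · obtain ⟨k', hk1, hk2⟩ := hvS s ((Finset.mem_insert.1 hs).resolve_left hsi)
        have hi' : v i ∈ NK σ hσ k' := hk2 i (fun e => hsi e.symm)
        refine ⟨k', fun hm => hk1 ?_, fun h hh => ?_⟩
        · rw [hback s, hv'i]
          exact Submodule.sub_mem _ hm (Submodule.smul_mem _ _ hi')
        · exact Submodule.add_mem _ (hk2 h hh) (Submodule.smul_mem _ _ hi')

/-- Proposition `special_gens`: for a modular support `σ` over a finite
commutative ring `R` with Jacobson radical `J`, `j ≥ 1`, and a code `C ⊆ 0:_{R^n} J`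
having a minimal system of generators of cardinality `j`, there is a minimal system of
generators `{v_1,…,v_j}` of `C` such that for each `i` there is a coordinate `k_i` with
`σ(v_i)_{k_i} ≠ 0` and `σ(v_h)_{k_i} = 0` for all `h ≠ i`. -/
theorem stmt_13 {R : Type*} [CommRing R] [Fintype R] [Nontrivial R] {n u : ℕ}
    (σ : (Fin n → R) → Fin u → ℕ) (hσ : IsSupport σ) (hmod : IsModular σ)
    (j : ℕ) (hj : 1 ≤ j)
    (C : Submodule R (Fin n → R))
    (hCJ : ∀ v ∈ C, ∀ r ∈ (⊥ : Ideal R).jacobson, r • v = (0 : Fin n → R))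
    (G : Finset (Fin n → R)) (hGcard : G.card = j)
    (hGmin : IsMinGenSet R (↑G : Set (Fin n → R)) C) :
    ∃ v : Fin j → (Fin n → R), Function.Injective v ∧
      IsMinGenSet R (Set.range v) C ∧
      ∀ i : Fin j, ∃ k : Fin u, σ (v i) k ≠ 0 ∧ ∀ h : Fin j, h ≠ i → σ (v h) k = 0 := by
  have hinj0 : Function.Injective (fun i : Fin j => ((G.equivFinOfCardEq hGcard).symm i : Fin n → R)) :=
    fun a b h => (G.equivFinOfCardEq hGcard).symm.injective (Subtype.ext h)
  set v₀ : Fin j → (Fin n → R) := fun i => ((G.equivFinOfCardEq hGcard).symm i : Fin n → R)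
    with hv₀
  have hrange : Set.range v₀ = (G : Set (Fin n → R)) := by
    ext x
    constructor
    · rintro ⟨i, rfl⟩
      exact ((G.equivFinOfCardEq hGcard).symm i).2
    · intro hx
      exact ⟨G.equivFinOfCardEq hGcard ⟨x, hx⟩, by simp [hv₀]⟩
  have hess : ∀ i, v₀ i ∉ Submodule.span R (v₀ '' {h | h ≠ i}) := by
    intro i hi
    have hsub : v₀ '' {h | h ≠ i} ⊆ (G : Set (Fin n → R)) := by
      rw [← hrange]
      exact Set.image_subset_range _ _
    have heq := hGmin.2 _ hsub (by
      rw [← hGmin.1]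
      apply le_antisymm (Submodule.span_mono hsub)
      rw [Submodule.span_le, ← hrange]
      rintro _ ⟨h, rfl⟩
      by_cases hh : h = i
      · rw [hh]; exact hi
      · exact Submodule.subset_span ⟨h, hh, rfl⟩)
    have : v₀ i ∈ v₀ '' {h | h ≠ i} := by
      rw [heq, ← hrange]
      exact ⟨i, rfl⟩
    obtain ⟨h, hh, e⟩ := this
    exact hh (hinj0 e)
  obtain ⟨v, hv, hve, hvS⟩ := main_ind σ hσ hmod j C hCJ v₀ (hrange ▸ hGmin.1) hess Finset.univ
  refine ⟨v, ?_, ⟨hv, ?_⟩, fun i => hvS i (Finset.mem_univ i)⟩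
  · intro a b hab
    by_contra hne
    exact hve a (Submodule.subset_span ⟨b, fun e => hne e.symm, hab.symm⟩)
  · intro G' hG' hs
    apply Set.Subset.antisymm hG'
    rintro _ ⟨i, rfl⟩
    by_contra hn
    apply hve i
    have h1 : v i ∈ Submodule.span R G' := by
      rw [hs, ← hv]
      exact Submodule.subset_span ⟨i, rfl⟩
    refine Submodule.span_mono ?_ h1
    intro x hx
    obtain ⟨h, rfl⟩ := hG' hx
    exact ⟨h, fun e => hn (e ▸ hx), rfl⟩
end

section
/- Let R = R_1 × … × R_ℓ be a product of finite local rings with Jacobson radical J. If σ : R^n → ℕ^u is a modular support, then u ≥ M(0:_{R^n} J). In particular, if each R_j is a finite chain ring, or if J·R^n = 0, then u ≥ ℓ·n. -/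
theorem aux_mu_le {R M : Type*} [Semiring R] [AddCommMonoid M] [Module R M]
    (s : Finset M) (D : Submodule R M) (h : Submodule.span R (s : Set M) = D) :
    mu R D ≤ s.card := Nat.sInf_le ⟨s, rfl, h⟩

theorem aux_mu_spec {R M : Type*} [Semiring R] [AddCommMonoid M] [Module R M] [Finite M]
    (D : Submodule R M) : ∃ s : Finset M, s.card = mu R D ∧ Submodule.span R (s : Set M) = D := by
  have : mu R D ∈ {k | ∃ s : Finset M, s.card = k ∧ Submodule.span R (s : Set M) = D} := by
    apply Nat.sInf_mem
    exact ⟨_, (Set.toFinite (D : Set M)).toFinset, rfl, by simp⟩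
  exact this

theorem aux_mu_succ {R M : Type*} [Semiring R] [AddCommMonoid M] [Module R M] [Finite M]
    (D D' : Submodule R M) (w : M) (h : D' = Submodule.span R {w} ⊔ D) :
    mu R D' ≤ mu R D + 1 := by
  classical
  obtain ⟨s, hs, hD⟩ := aux_mu_spec D
  rw [← hs]
  refine (aux_mu_le (insert w s) D' ?_).trans (Finset.card_insert_le _ _)
  rw [Finset.coe_insert, Submodule.span_insert, hD, h]

theorem aux_soc_elt (R : Type*) [CommRing R] [Finite R] [IsLocalRing R] :
    ∃ a : R, a ≠ 0 ∧ ∀ b ∈ IsLocalRing.maximalIdeal R, b * a = 0 := by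
  classical
  have hn : ∃ k, (IsLocalRing.maximalIdeal R) ^ k = ⊥ := by
    have := IsArtinianRing.isNilpotent_jacobson_bot (R := R)
    rwa [IsLocalRing.jacobson_eq_maximalIdeal _ bot_ne_top] at this
  have h1 := Nat.find_spec hn
  cases hk : Nat.find hn with
  | zero =>
    rw [hk, pow_zero] at h1
    exact absurd h1 (by simp)
  | succ k =>
    have h2 := Nat.find_min hn (m := k) (by omega)
    rw [hk] at h1
    obtain ⟨a, ha, ha0⟩ := Submodule.exists_mem_ne_zero_of_ne_bot h2
    refine ⟨a, ha0, fun b hb => ?_⟩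
    have : b * a ∈ (IsLocalRing.maximalIdeal R) ^ (k + 1) := by
      rw [pow_succ']; exact Ideal.mul_mem_mul hb ha
    rw [h1] at this
    simpa using this

theorem aux_mu_lower {R : Type*} [CommRing R] [Finite R] [IsLocalRing R] {n : ℕ}
    (D : Submodule R (Fin n → R))
    (hk : ∀ r ∈ IsLocalRing.maximalIdeal R, ∀ v ∈ D, r • v = 0)
    (a : R) (ha : a ≠ 0) (hD : ∀ i, Pi.single i a ∈ D) : n ≤ mu R D := by
  classical
  obtain ⟨s, hs, hsp⟩ := aux_mu_spec D
  rw [← hs]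
  have htor : Module.IsTorsionBySet R D (IsLocalRing.maximalIdeal R : Set R) := by
    rintro ⟨x, hx⟩ ⟨r, hr⟩
    exact Subtype.ext (hk r hr x hx)
  letI := htor.module
  letI : Field (R ⧸ IsLocalRing.maximalIdeal R) := Ideal.Quotient.field _
  have hli : LinearIndependent (R ⧸ IsLocalRing.maximalIdeal R)
      (fun i : Fin n => (⟨Pi.single i a, hD i⟩ : D)) := by
    rw [Fintype.linearIndependent_iff]
    intro g hg i
    choose r hr using fun i => Ideal.Quotient.mk_surjective (g i)
    have h1 : ∑ i, r i • (⟨Pi.single i a, hD i⟩ : D) = 0 := by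
      rw [← hg]
      refine Finset.sum_congr rfl fun i _ => ?_
      rw [← hr i]; rfl
    have h2 := congrFun (congrArg Subtype.val h1) i
    simp [Finset.sum_apply, Pi.single_apply] at h2
    rw [← hr i, Ideal.Quotient.eq_zero_iff_mem, IsLocalRing.mem_maximalIdeal, mem_nonunits_iff]
    intro hu
    exact ha ((hu.mul_right_eq_zero).1 h2)
  have hsD : ∀ x ∈ s, x ∈ D := fun x hx => hsp ▸ Submodule.subset_span hx
  have hsp2 : Submodule.span (R ⧸ IsLocalRing.maximalIdeal R)
      (Set.range fun x : s => (⟨x.1, hsD _ x.2⟩ : D)) = ⊤ := by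
    rw [eq_top_iff]
    rintro ⟨x, hx⟩ -
    have hx' := hx
    rw [← hsp] at hx'
    induction hx' using Submodule.span_induction with
    | mem x h => exact Submodule.subset_span ⟨⟨x, h⟩, rfl⟩
    | zero => exact Submodule.zero_mem _
    | add x y hxs hys h1 h2 =>
      exact Submodule.add_mem _ (h1 (hsp ▸ hxs)) (h2 (hsp ▸ hys))
    | smul c x hxs h1 =>
      exact Submodule.smul_mem _ (Ideal.Quotient.mk _ c) (h1 (hsp ▸ hxs))
  have h3 := hli.fintype_card_le_finrank
  have h4 := finrank_range_le_card (R := R ⧸ IsLocalRing.maximalIdeal R)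
    (fun x : s => (⟨x.1, hsD _ x.2⟩ : D))
  rw [Set.finrank, hsp2, finrank_top] at h4
  simpa using h3.trans h4

theorem aux_jac_s14 {ℓ : ℕ} {Rj : Fin ℓ → Type*} [∀ j, CommRing (Rj j)]
    [∀ j, IsLocalRing (Rj j)] (r : ∀ j, Rj j) :
    r ∈ (⊥ : Ideal (∀ j, Rj j)).jacobson ↔ ∀ j, r j ∈ IsLocalRing.maximalIdeal (Rj j) := by
  classical
  rw [Ideal.mem_jacobson_bot]
  constructor
  · intro h j
    rw [← IsLocalRing.jacobson_eq_maximalIdeal _ bot_ne_top, Ideal.mem_jacobson_bot]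
    intro y
    simpa using Pi.isUnit_iff.1 (h (Pi.single j y)) j
  · intro h y
    rw [Pi.isUnit_iff]
    intro j
    have := h j
    rw [← IsLocalRing.jacobson_eq_maximalIdeal _ bot_ne_top, Ideal.mem_jacobson_bot] at this
    exact this (y j)

theorem aux_mem_soc {R M : Type*} [CommRing R] [AddCommGroup M] [Module R M] (v : M) :
    v ∈ socJ (⊤ : Submodule R M) ↔ ∀ r ∈ (⊥ : Ideal R).jacobson, r • v = 0 := by
  simp [socJ, Submodule.mem_iInf]

/-- Vectors whose `i`-th support component vanishes. -/
def auxF {R : Type*} [CommRing R] {n u : ℕ} (σ : (Fin n → R) → Fin u → ℕ) (hσ : IsSupport σ)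
    (i : Fin u) : Submodule R (Fin n → R) where
  carrier := {v | σ v i = 0}
  zero_mem' := by
    have := (hσ.1 0).2 rfl
    simp [this]
  add_mem' := by
    intro a b ha hb
    have := hσ.2.2 a b i
    simp only [Set.mem_setOf_eq, Pi.sup_apply] at *
    rw [ha, hb] at this
    simpa using this
  smul_mem' := by
    intro c a ha
    have := hσ.2.1 c a i
    simp only [Set.mem_setOf_eq] at *
    omega

theorem aux_chain1 {R : Type*} [CommRing R] {n u : ℕ} (σ : (Fin n → R) → Fin u → ℕ)
    (hmod : IsModular σ) (i : Fin u) (w : Fin n → R) :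
    ∀ (N : ℕ) (v : Fin n → R), σ v i = N → σ v i ≤ σ w i → ∃ r : R, σ (v + r • w) i = 0 := by
  intro N
  induction N using Nat.strong_induction_on with
  | _ N ih =>
    intro v hv hle
    by_cases h0 : σ v i = 0
    · exact ⟨0, by simpa using h0⟩
    · obtain ⟨r, hr⟩ := hmod v w i h0 hle
      obtain ⟨r', hr'⟩ := ih _ (hv ▸ hr) (v + r • w) rfl (by omega)
      exact ⟨r + r', by rwa [add_smul, ← add_assoc]⟩

theorem aux_chain {R : Type*} [CommRing R] {n u : ℕ} (σ : (Fin n → R) → Fin u → ℕ)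
    (hσ : IsSupport σ) (hmod : IsModular σ) (i : Fin u) (v w : Fin n → R) :
    (∃ r : R, v + r • w ∈ auxF σ hσ i) ∨ (∃ r : R, w + r • v ∈ auxF σ hσ i) := by
  rcases le_total (σ v i) (σ w i) with h | h
  · exact Or.inl (aux_chain1 σ hmod i w _ v rfl h)
  · exact Or.inr (aux_chain1 σ hmod i v _ w rfl h)

theorem aux_proj_mono {ℓ n : ℕ} {Rj : Fin ℓ → Type*} [∀ j, CommRing (Rj j)]
    {C D : Submodule (∀ j, Rj j) (Fin n → ∀ j, Rj j)} (h : C ≤ D) (j : Fin ℓ) :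
    projCode C j ≤ projCode D j :=
  Submodule.span_mono fun _ ⟨v, hv, e⟩ => ⟨v, h hv, e⟩

theorem aux_step {ℓ n : ℕ} {Rj : Fin ℓ → Type*} [∀ j, CommRing (Rj j)]
    [∀ j, Finite (Rj j)] [∀ j, IsLocalRing (Rj j)]
    (C F : Submodule (∀ j, Rj j) (Fin n → ∀ j, Rj j)) (hC : C ≤ socJ ⊤)
    (hF : ∀ v w, (∃ r : ∀ j, Rj j, v + r • w ∈ F) ∨ (∃ r : ∀ j, Rj j, w + r • v ∈ F)) :
    Mnum C ≤ Mnum (C ⊓ F) + 1 := by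
  classical
  by_cases hCF : C ≤ F
  · rw [inf_eq_left.2 hCF]; omega
  obtain ⟨w0, hw0, hw0F⟩ := SetLike.not_le_iff_exists.1 hCF
  let e : Fin ℓ → ∀ j, Rj j := fun j => Pi.single j 1
  have hdec : ∀ v : Fin n → ∀ j, Rj j, v = ∑ j, e j • v := by
    intro v
    rw [← Finset.sum_smul]
    have : ∑ j, e j = 1 := Finset.univ_sum_single (1 : ∀ j, Rj j)
    rw [this, one_smul]
  have hee : ∀ j, e j * e j = e j := fun j => by
    simp only [e, ← Pi.single_mul, mul_one]
  have hek : ∀ j k, j ≠ k → e j * e k = 0 := fun j k hjk => by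
    ext i
    by_cases h : i = j
    · subst h; simp [e, Pi.single_apply, hjk]
    · simp [e, Pi.single_apply, h]
  obtain ⟨j, hj⟩ : ∃ j, e j • w0 ∉ F := by
    by_contra! h
    exact hw0F (hdec w0 ▸ Submodule.sum_mem _ fun j _ => h j)
  obtain ⟨w, hw⟩ : ∃ w, w = e j • w0 := ⟨_, rfl⟩
  rw [← hw] at hj
  have hwC : w ∈ C := hw ▸ C.smul_mem _ hw0
  have hew : e j • w = w := by rw [hw, smul_smul, hee]
  have hew0 : ∀ k, k ≠ j → e k • w = 0 := fun k hk => by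
    rw [hw, smul_smul, hek k j hk, zero_smul]
  have hothers : ∀ v, ∀ k, k ≠ j → e k • v ∈ F := by
    intro v k hk
    rcases hF (e k • v) w with ⟨r, hr⟩ | ⟨r, hr⟩
    · have := F.smul_mem (e k) hr
      rwa [smul_add, smul_smul, hee, smul_comm, hew0 k hk, smul_zero, add_zero] at this
    · have := F.smul_mem (e j) hr
      rw [smul_add, hew, smul_comm, smul_smul (e j), hek j k hk.symm, zero_smul, smul_zero,
        add_zero] at this
      exact absurd this hj
  have hmain : ∀ v ∈ C, ∃ s : ∀ j, Rj j, e j • v + s • w ∈ F := by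
    intro v hv
    rcases hF (e j • v) w with h | ⟨r, hr⟩
    · exact h
    · have hu : IsUnit (r j) := by
        by_contra hnu
        have hJ : r * e j ∈ (⊥ : Ideal (∀ j, Rj j)).jacobson := by
          rw [aux_jac_s14]
          intro k
          by_cases hk : k = j
          · subst hk
            simpa [e] using hnu
          · simp [e, hk]
        rw [smul_smul, (aux_mem_soc v).1 (hC hv) _ hJ, add_zero] at hr
        exact hj hr
      obtain ⟨t, ht⟩ := hu.exists_left_inv
      refine ⟨Pi.single j t, ?_⟩
      have := F.smul_mem (Pi.single j t : ∀ j, Rj j) hr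
      rw [smul_add, smul_smul, smul_smul] at this
      have h1 : (Pi.single j t : ∀ j, Rj j) * (r * e j) = e j := by
        ext k
        by_cases hk : k = j
        · subst hk; simpa [e] using ht
        · simp [e, hk]
      rw [← mul_assoc] at h1
      simp only [← mul_assoc, h1] at this
      rwa [add_comm] at this
  have hmain2 : ∀ v ∈ C, ∃ s : ∀ j, Rj j, v + s • w ∈ C ⊓ F := by
    intro v hv
    obtain ⟨s, hs⟩ := hmain v hv
    refine ⟨s, C.add_mem hv (C.smul_mem _ hwC), ?_⟩
    have h1 : v = e j • v + ∑ k ∈ Finset.univ.erase j, e k • v := by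
      rw [Finset.add_sum_erase _ (fun k => e k • v) (Finset.mem_univ j)]
      exact hdec v
    have h2 : v + s • w = (e j • v + s • w) + ∑ k ∈ Finset.univ.erase j, e k • v := by
      nth_rewrite 1 [h1]; abel
    rw [h2]
    exact F.add_mem hs (F.sum_mem fun k hk => hothers v k (Finset.ne_of_mem_erase hk))
  have hj1 : mu (Rj j) (projCode C j) ≤ mu (Rj j) (projCode (C ⊓ F) j) + 1 := by
    refine aux_mu_succ _ _ (fun i => w i j) (le_antisymm ?_ ?_)
    · refine Submodule.span_le.2 ?_
      rintro _ ⟨v, hv, rfl⟩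
      obtain ⟨s, hs⟩ := hmain2 v hv
      have h3 : (fun i => v i j) = (-s j) • (fun i => w i j) + fun i => (v + s • w) i j := by
        ext i; simp
      rw [h3]
      exact Submodule.add_mem_sup (Submodule.smul_mem _ _ (Submodule.mem_span_singleton_self _))
        (Submodule.subset_span ⟨_, hs, rfl⟩)
    · refine sup_le ?_ (aux_proj_mono inf_le_left j)
      rw [Submodule.span_singleton_le_iff_mem]
      exact Submodule.subset_span ⟨w, hwC, rfl⟩
  have hk1 : ∀ k, k ≠ j → projCode C k = projCode (C ⊓ F) k := by
    intro k hk
    refine le_antisymm (Submodule.span_le.2 ?_) (aux_proj_mono inf_le_left k)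
    rintro _ ⟨v, hv, rfl⟩
    refine Submodule.subset_span ⟨e k • v, ⟨C.smul_mem _ hv, hothers v k hk⟩, ?_⟩
    ext i; simp [e]
  unfold Mnum
  rw [← Finset.add_sum_erase _ _ (Finset.mem_univ j),
    ← Finset.add_sum_erase _ (fun j => mu (Rj j) (projCode (C ⊓ F) j)) (Finset.mem_univ j)]
  have : ∑ k ∈ Finset.univ.erase j, mu (Rj k) (projCode C k) =
      ∑ k ∈ Finset.univ.erase j, mu (Rj k) (projCode (C ⊓ F) k) :=
    Finset.sum_congr rfl fun k hk => by rw [hk1 k (Finset.ne_of_mem_erase hk)]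
  rw [this]
  omega

theorem aux_iter {ℓ n u : ℕ} {Rj : Fin ℓ → Type*} [∀ j, CommRing (Rj j)]
    [∀ j, Finite (Rj j)] [∀ j, IsLocalRing (Rj j)]
    (σ : (Fin n → ∀ j, Rj j) → Fin u → ℕ) (hσ : IsSupport σ) (hmod : IsModular σ)
    (s : Finset (Fin u)) :
    Mnum (socJ (⊤ : Submodule (∀ j, Rj j) (Fin n → ∀ j, Rj j))) ≤
      Mnum (socJ (⊤ : Submodule (∀ j, Rj j) (Fin n → ∀ j, Rj j)) ⊓ s.inf (auxF σ hσ)) + s.card := by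
  classical
  induction s using Finset.induction_on with
  | empty => simp
  | insert a s ha ih =>
    have := aux_step (socJ ⊤ ⊓ s.inf (auxF σ hσ)) (auxF σ hσ a) inf_le_left
      (aux_chain σ hσ hmod a)
    rw [Finset.inf_insert, Finset.card_insert_of_notMem ha, inf_comm (auxF σ hσ a), ← inf_assoc]
    omega

theorem aux_main_s14 {ℓ n u : ℕ} {Rj : Fin ℓ → Type*} [∀ j, CommRing (Rj j)]
    [∀ j, Finite (Rj j)] [∀ j, IsLocalRing (Rj j)]
    (σ : (Fin n → ∀ j, Rj j) → Fin u → ℕ) (hσ : IsSupport σ) (hmod : IsModular σ) :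
    Mnum (socJ (⊤ : Submodule (∀ j, Rj j) (Fin n → ∀ j, Rj j))) ≤ u := by
  have h := aux_iter σ hσ hmod Finset.univ
  have hb : socJ (⊤ : Submodule (∀ j, Rj j) (Fin n → ∀ j, Rj j)) ⊓
      Finset.univ.inf (auxF σ hσ) = ⊥ := by
    rw [eq_bot_iff]
    rintro v ⟨-, hv⟩
    rw [Submodule.mem_bot, ← hσ.1]
    ext i
    exact (Finset.inf_le (f := auxF σ hσ) (Finset.mem_univ i)) hv
  rw [hb] at h
  have h0 : Mnum (⊥ : Submodule (∀ j, Rj j) (Fin n → ∀ j, Rj j)) = 0 := by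
    refine Finset.sum_eq_zero fun j _ => ?_
    refine Nat.le_zero.1 (aux_mu_le ∅ _ ?_)
    rw [Finset.coe_empty, Submodule.span_empty, eq_comm, eq_bot_iff]
    refine Submodule.span_le.2 ?_
    rintro _ ⟨v, hv, rfl⟩
    rw [(Submodule.mem_bot _).1 hv]
    exact Submodule.zero_mem _
  simpa [h0] using h

theorem aux_lower {ℓ n : ℕ} {Rj : Fin ℓ → Type*} [∀ j, CommRing (Rj j)]
    [∀ j, Finite (Rj j)] [∀ j, IsLocalRing (Rj j)] :
    ℓ * n ≤ Mnum (socJ (⊤ : Submodule (∀ j, Rj j) (Fin n → ∀ j, Rj j))) := by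
  classical
  have key : ∀ j, n ≤ mu (Rj j)
      (projCode (socJ (⊤ : Submodule (∀ j, Rj j) (Fin n → ∀ j, Rj j))) j) := by
    intro j
    obtain ⟨a, ha, hka⟩ := aux_soc_elt (Rj j)
    refine aux_mu_lower _ ?_ a ha ?_
    · intro r hr v hv
      induction hv using Submodule.span_induction with
      | mem x h =>
        obtain ⟨v, hv, rfl⟩ := h
        have hJ : (Pi.single j r : ∀ j, Rj j) ∈ (⊥ : Ideal (∀ j, Rj j)).jacobson := by
          rw [aux_jac_s14]
          intro k
          by_cases hk : k = j
          · subst hk; simpa using hr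
          · simp [hk]
        have h1 := (aux_mem_soc v).1 hv _ hJ
        ext i
        simpa using congrFun (congrFun h1 i) j
      | zero => simp
      | add x y _ _ h1 h2 => rw [smul_add, h1, h2, add_zero]
      | smul c x _ h1 => rw [smul_comm, h1, smul_zero]
    · intro i
      refine Submodule.subset_span ⟨Pi.single i (Pi.single j a), ?_, ?_⟩
      · rw [aux_mem_soc]
        intro r hr
        rw [aux_jac_s14] at hr
        ext i' k
        by_cases hi : i' = i
        · subst hi
          by_cases hk : k = j
          · subst hk; simpa using hka _ (hr k)
          · simp [hk]
        · simp [hi]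
      · ext i'
        by_cases hi : i' = i
        · subst hi; simp
        · simp [hi]
  calc ℓ * n = ∑ _j : Fin ℓ, n := by simp
    _ ≤ _ := Finset.sum_le_sum fun j _ => key j

/-- over a product `R = R_1 × … × R_ℓ` of finite local rings with
Jacobson radical `J`, a modular support `σ : R^n → ℕ^u` forces `u ≥ M(0:_{R^n} J)`;
in particular `u ≥ ℓ·n` if each `R_j` is a finite chain ring, or if `J·R^n = 0`. -/
theorem stmt_14 {ℓ n u : ℕ} {Rj : Fin ℓ → Type*} [∀ j, CommRing (Rj j)] [∀ j, Fintype (Rj j)]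
    [∀ j, IsLocalRing (Rj j)]
    (σ : (Fin n → ∀ j, Rj j) → Fin u → ℕ) (hσ : IsSupport σ) (hmod : IsModular σ) :
    Mnum (socJ (⊤ : Submodule (∀ j, Rj j) (Fin n → ∀ j, Rj j))) ≤ u ∧
    ((∀ j, IsPrincipalIdealRing (Rj j)) → ℓ * n ≤ u) ∧
    ((∀ r ∈ (⊥ : Ideal (∀ j, Rj j)).jacobson, ∀ v : Fin n → ∀ j, Rj j,
        r • v = (0 : Fin n → ∀ j, Rj j)) → ℓ * n ≤ u) := by
  have h := aux_main_s14 σ hσ hmod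
  exact ⟨h, fun _ => aux_lower.trans h, fun _ => aux_lower.trans h⟩
end

section
/- Let R = R_1 × … × R_ℓ be a finite principal ideal ring (a product of finite chain rings) with Jacobson radical J, let σ : R^n → ℕ^u be a modular support, and let C ⊆ R^n be an R-linear code. Let r ∈ {1,…,M(C)} and let D ∈ 𝒮_j(C) for some j ≥ r be such that d_r(C) = |σ(D)|. Then 0:_D J ∈ 𝒮_i(C) for some i ≥ r and d_r(C) = |σ(0:_D J)|. In particular, d_r(C) = d_r(0:_C J). -/
section Helpers

variable {R M : Type*} [CommRing R] [AddCommGroup M] [Module R M]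

theorem mem_socJ {C : Submodule R M} {x : M} :
    x ∈ socJ C ↔ x ∈ C ∧ ∀ a ∈ (⊥ : Ideal R).jacobson, a • x = 0 := by
  simp [socJ, Submodule.mem_iInf]

/-- Chain argument: an irredundant set modulo `K` has at most `length D - length K` elements. -/
theorem card_add_length_le [IsArtinian R M] [IsNoetherian R M] (K : Submodule R M) (G : Finset M)
    (hG : ∀ g ∈ G, g ∉ Submodule.span R ((G : Set M) \ {g}) ⊔ K) :
    ∀ G' : Finset M, G' ⊆ G → (G'.card : ℕ∞) + Order.height K ≤
      Order.height (Submodule.span R (G' : Set M) ⊔ K) := by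
  classical
  intro G'
  induction G' using Finset.induction_on with
  | empty => intro _; simp
  | insert a s has ih =>
    intro hs
    have h1 := ih ((Finset.subset_insert a s).trans hs)
    have haG : a ∈ G := hs (Finset.mem_insert_self a s)
    have hlt : Submodule.span R (s : Set M) ⊔ K <
        Submodule.span R ((insert a s : Finset M) : Set M) ⊔ K := by
      refine lt_of_le_of_ne (sup_le_sup_right (Submodule.span_mono (by simp)) K) fun heq => ?_
      have ha : a ∈ Submodule.span R (s : Set M) ⊔ K := by
        rw [heq]
        exact Submodule.mem_sup_left (Submodule.subset_span (by simp))
      refine hG a haG (sup_le_sup_right (Submodule.span_mono ?_) K ha)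
      intro x hx
      refine ⟨hs (Finset.mem_insert_of_mem hx), ?_⟩
      rintro rfl
      exact has hx
    have h2 := Submodule.height_strictMono hlt
    rw [Finset.card_insert_of_notMem has]
    have h3 := Order.add_one_le_of_lt h2
    calc ((s.card + 1 : ℕ) : ℕ∞) + Order.height K
        = (s.card + Order.height K) + 1 := by push_cast; ring
      _ ≤ _ := (add_le_add_left h1 1).trans h3

theorem card_le_length_socJ [IsArtinian R M] [IsNoetherian R M] [IsPrincipalIdealRing R]
    (D : Submodule R M) (G : Finset M) (hG : IsMinGenSet R (G : Set M) D) :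
    (G.card : ℕ∞) ≤ Module.length R (socJ D) := by
  obtain ⟨a, ha⟩ := (IsPrincipalIdealRing.principal (⊥ : Ideal R).jacobson).principal
  have haJ : a ∈ (⊥ : Ideal R).jacobson := by
    rw [ha]; exact Submodule.mem_span_singleton_self a
  set K : Submodule R M := D.map (LinearMap.lsmul R M a) with hK
  have hKD : K ≤ D := by
    rintro _ ⟨x, hx, rfl⟩
    exact D.smul_mem a hx
  have hJD : (⊥ : Ideal R).jacobson • D = K := by
    rw [ha]
    change Ideal.span {a} • D = K
    rw [Submodule.ideal_span_singleton_smul]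
    rfl
  have key := card_add_length_le K G (by
    intro g hg hmem
    have hDle : D ≤ Submodule.span R ((G : Set M) \ {g}) ⊔ K := by
      rw [← hG.1, Submodule.span_le]
      intro x hx
      by_cases hxg : x = g
      · subst hxg; exact hmem
      · exact Submodule.mem_sup_left (Submodule.subset_span ⟨hx, hxg⟩)
    rw [← hJD] at hDle
    have h1 := Submodule.le_of_le_smul_of_le_jacobson_bot (IsNoetherian.noetherian D) le_rfl hDle
    have h2 : Submodule.span R ((G : Set M) \ {g}) = D :=
      le_antisymm (by rw [← hG.1]; exact Submodule.span_mono Set.diff_subset) h1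
    have h3 := hG.2 _ Set.diff_subset h2
    have : g ∈ (G : Set M) \ {g} := by rw [h3]; exact hg
    exact this.2 rfl) G subset_rfl
  rw [hG.1, sup_eq_left.2 hKD, ← Module.length_submodule, ← Module.length_submodule] at key
  have hS : socJ D ≤ D := inf_le_left
  let g : D →ₗ[R] K := (LinearMap.lsmul R M a).restrict
    (p := D) (q := K) (fun x hx => Submodule.mem_map_of_mem hx)
  have hlen : Module.length R D = Module.length R (socJ D) + Module.length R K := by
    refine Module.length_eq_add_of_exact (Submodule.inclusion hS) g
      (Submodule.inclusion_injective hS) ?_ ?_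
    · rintro ⟨_, x, hx, rfl⟩
      exact ⟨⟨x, hx⟩, rfl⟩
    · intro x
      constructor
      · intro hx
        have hx' : a • (x : M) = 0 := congrArg Subtype.val hx
        refine ⟨⟨x, mem_socJ.2 ⟨x.2, fun b hb => ?_⟩⟩, rfl⟩
        rw [ha] at hb
        obtain ⟨c, rfl⟩ := Submodule.mem_span_singleton.1 hb
        rw [smul_assoc, hx', smul_zero]
      · rintro ⟨y, rfl⟩
        exact Subtype.ext ((mem_socJ.1 y.2).2 a haJ)
  rw [hlen] at key
  exact (ENat.add_le_add_iff_right Module.length_ne_top).1 key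

theorem exists_minGenSet_socJ [IsArtinianRing R] [IsNoetherian R M]
    (D : Submodule R M) :
    ∃ G : Finset M, (G.card : ℕ∞) = Module.length R (socJ D) ∧
      IsMinGenSet R (G : Set M) (socJ D) := by
  classical
  have htor : Module.IsTorsionBySet R (socJ D) (Ring.jacobson R : Set R) := by
    rintro ⟨x, hx⟩ ⟨b, hb⟩
    refine Subtype.ext ((mem_socJ.1 hx).2 b ?_)
    rw [Ideal.jacobson_bot]; exact hb
  have hss : IsSemisimpleModule R (socJ D) := by
    let _ := htor.module
    exact (htor.semilinearMap.isSemisimpleModule_iff_of_bijective Function.bijective_id).2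
      inferInstance
  obtain ⟨k, S, e0, hS⟩ := IsSemisimpleModule.exists_linearEquiv_fin_dfinsupp R (socJ D)
  let e : socJ D ≃ₗ[R] (∀ i, S i) := e0.trans DFinsupp.linearEquivFunOnFintype
  have hx : ∀ i, ∃ x : S i, x ≠ 0 := fun i => by
    have := IsSimpleModule.nontrivial R (S i)
    exact exists_ne 0
  choose x hx using hx
  let f : Fin k → M := fun i => (e.symm (Pi.single i (x i)) : M)
  have hcoord : ∀ (i : Fin k) (G' : Set M), G' ⊆ Set.range f → f i ∉ G' →
      ∀ (y : socJ D), (y : M) ∈ Submodule.span R G' → e y i = 0 := by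
    intro i G' hG' hi y hy
    have hle : Submodule.span R G' ≤
        (LinearMap.ker ((LinearMap.proj i).comp e.toLinearMap)).map (socJ D).subtype := by
      rw [Submodule.span_le]
      intro z hz
      obtain ⟨j, rfl⟩ := hG' hz
      have hij : i ≠ j := by rintro rfl; exact hi hz
      refine ⟨e.symm (Pi.single j (x j)), ?_, rfl⟩
      simp [hij]
    obtain ⟨z, hz, hzy⟩ := hle hy
    obtain rfl : z = y := Subtype.ext hzy
    simpa using hz
  have hne : ∀ i, e (e.symm (Pi.single i (x i))) i ≠ 0 := by
    intro i; simpa using hx i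
  have hinj : Function.Injective f := by
    intro i j hij
    by_contra hne'
    have := e.symm.injective (Subtype.ext hij)
    have h2 := congrFun this i
    rw [Pi.single_eq_same, Pi.single_eq_of_ne hne'] at h2
    exact hx i h2
  have hspan : Submodule.span R (Set.range f) = socJ D := by
    apply le_antisymm
    · rw [Submodule.span_le]
      rintro _ ⟨i, rfl⟩
      exact (e.symm (Pi.single i (x i))).2
    · intro y hy
      have hy' : (⟨y, hy⟩ : socJ D) = ∑ i, e.symm (Pi.single i (e ⟨y, hy⟩ i)) := by
        rw [← map_sum, Finset.univ_sum_single, e.symm_apply_apply]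
      have hy2 : y = ∑ i, (e.symm (Pi.single i (e ⟨y, hy⟩ i)) : M) := by
        have := congrArg Subtype.val hy'
        simpa using this
      rw [hy2]
      refine Submodule.sum_mem _ fun i _ => ?_
      have := hS i
      obtain ⟨c, hc⟩ := IsSimpleModule.toSpanSingleton_surjective R (hx i) (e ⟨y, hy⟩ i)
      rw [← hc, LinearMap.toSpanSingleton_apply, Pi.single_smul, map_smul]
      exact Submodule.smul_mem _ c (Submodule.subset_span ⟨i, rfl⟩)
  refine ⟨Finset.univ.image f, ?_, ?_, ?_⟩
  · rw [Finset.card_image_of_injective _ hinj, e.length_eq, Module.length_pi_of_fintype]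
    have : ∀ i, Module.length R (S i) = 1 := fun i => Module.length_eq_one_iff.2 (hS i)
    simp [this]
  · simpa using hspan
  · intro G' hG' hs
    have hG'' : G' ⊆ Set.range f := by simpa using hG'
    refine le_antisymm hG' ?_
    intro z hz
    simp only [Finset.coe_image, Finset.coe_univ, Set.image_univ, Set.mem_range] at hz
    obtain ⟨i, rfl⟩ := hz
    by_contra hi
    exact hne i (hcoord i G' hG'' hi _ (by rw [hs]; exact (e.symm (Pi.single i (x i))).2))

theorem suppOf_mono [Finite M] {u : ℕ} (σ : M → Fin u → ℕ) {A B : Set M} (h : A ⊆ B)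
    (hA : A.Nonempty) : ∑ i, suppOf σ A i ≤ ∑ i, suppOf σ B i :=
  Finset.sum_le_sum fun _ _ => csSup_le_csSup (Set.toFinite _).bddAbove (hA.image _)
    (Set.image_mono h)

end Helpers

/-- Proposition `prop:replacew/ann`: over a finite principal ideal ring
`R = R_1 × … × R_ℓ` (a product of finite chain rings) with Jacobson radical `J`, for a
modular support `σ`, a code `C ⊆ R^n`, `r ∈ {1,…,M(C)}` and `D ∈ 𝒮_j(C)` with `j ≥ r`
and `d_r(C) = |σ(D)|`: then `0:_D J ∈ 𝒮_i(C)` for some `i ≥ r`,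
`d_r(C) = |σ(0:_D J)|`, and `d_r(C) = d_r(0:_C J)`. -/
theorem stmt_15 {ℓ n u : ℕ} {Rj : Fin ℓ → Type*} [∀ j, CommRing (Rj j)] [∀ j, Fintype (Rj j)]
    [∀ j, IsLocalRing (Rj j)] [∀ j, IsPrincipalIdealRing (Rj j)]
    (σ : (Fin n → ∀ j, Rj j) → Fin u → ℕ) (hσ : IsSupport σ) (hmod : IsModular σ)
    (C : Submodule (∀ j, Rj j) (Fin n → ∀ j, Rj j))
    (r j : ℕ) (hr1 : 1 ≤ r) (hrM : r ≤ Mnum C) (hrj : r ≤ j)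
    (D : Submodule (∀ j, Rj j) (Fin n → ∀ j, Rj j)) (hD : memS j C D)
    (hd : dGW σ r C = ∑ i, suppOf σ (D : Set (Fin n → ∀ j, Rj j)) i) :
    (∃ i, r ≤ i ∧ memS i C (socJ D)) ∧
    dGW σ r C = ∑ i, suppOf σ (socJ D : Set (Fin n → ∀ j, Rj j)) i ∧
    dGW σ r C = dGW σ r (socJ C) := by
  have hsoc : (∃ i, r ≤ i ∧ memS i C (socJ D)) := by
    obtain ⟨hDC, G, hGc, hG⟩ := hD
    obtain ⟨G2, hc2, hG2⟩ := exists_minGenSet_socJ D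
    have h := card_le_length_socJ D G hG
    rw [← hc2, Nat.cast_le, hGc] at h
    exact ⟨G2.card, hrj.trans h, inf_le_left.trans hDC, G2, rfl, hG2⟩
  obtain ⟨i, hi, hmem⟩ := hsoc
  have hle : dGW σ r C ≤ ∑ i, suppOf σ (socJ D : Set (Fin n → ∀ j, Rj j)) i :=
    Nat.sInf_le ⟨i, hi, _, hmem, rfl⟩
  have hge : ∑ i, suppOf σ (socJ D : Set (Fin n → ∀ j, Rj j)) i ≤ dGW σ r C := by
    rw [hd]
    exact suppOf_mono σ (show (socJ D : Set (Fin n → ∀ j, Rj j)) ⊆ D from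
      fun x hx => (mem_socJ.1 hx).1) ⟨0, (socJ D).zero_mem⟩
  have heq := le_antisymm hle hge
  have hmem' : memS i (socJ C) (socJ D) :=
    ⟨fun x hx => mem_socJ.2 ⟨hD.1 (mem_socJ.1 hx).1, (mem_socJ.1 hx).2⟩, hmem.2⟩
  refine ⟨⟨i, hi, hmem⟩, heq, le_antisymm ?_ ?_⟩
  · refine le_csInf ⟨_, i, hi, _, hmem', rfl⟩ ?_
    rintro w ⟨k, hk, E, hE, rfl⟩
    exact Nat.sInf_le ⟨k, hk, E, ⟨hE.1.trans inf_le_left, hE.2⟩, rfl⟩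
  · rw [heq]
    exact Nat.sInf_le ⟨i, hi, _, hmem', rfl⟩
end
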